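/- There exists a constant K > 0 such that, with high probability, the final graph G_N of the König process satisfies: for every minimum vertex cover C of G_N, the number of vertex pairs {u, v} ⊆ V with {u, v} ∩ C ≠ ∅ that are not edges of G_N is at most K·n. -/

import Mathlib

open scoped Classical

noncomputable section

/-- `M` is a matching in the graph `G`: a set of edges of `G` that are pairwise disjoint. -/
def IsMatchingOn {n : ℕ} (G : SimpleGraph (Fin n)) (M : Finset (Sym2 (Fin n))) : Prop :=
  (∀ e ∈ M, e ∈ G.edgeSet) ∧
  ∀ e ∈ M, ∀ f ∈ M, e ≠ f → ∀ v : Fin n, v ∈ e → v ∉ f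

/-- ν(G): the maximum size of a matching of `G`. -/
def matchNum {n : ℕ} (G : SimpleGraph (Fin n)) : ℕ :=
  sSup {k | ∃ M : Finset (Sym2 (Fin n)), IsMatchingOn G M ∧ M.card = k}

/-- `C` is a vertex cover of `G`. -/
def IsVertexCover {n : ℕ} (G : SimpleGraph (Fin n)) (C : Finset (Fin n)) : Prop :=
  ∀ e ∈ G.edgeSet, ∃ v ∈ C, v ∈ e

/-- τ(G): the minimum size of a vertex cover of `G`. -/
def coverNum {n : ℕ} (G : SimpleGraph (Fin n)) : ℕ :=
  sInf {k | ∃ C : Finset (Fin n), IsVertexCover G C ∧ C.card = k}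

/-- `G` is a König graph: ν(G) = τ(G). -/
def IsKonig {n : ℕ} (G : SimpleGraph (Fin n)) : Prop := matchNum G = coverNum G

/-- An ordering `e_1, …, e_N` (0-indexed: `σ 0, …, σ (N-1)`) of the `N = n(n-1)/2` edges of
the complete graph on `Fin n`: an injective function from `Fin N` to non-diagonal elements
of `Sym2 (Fin n)`, hence a bijection onto the edge set of `K_n`. -/
def EdgeOrdering (n : ℕ) : Type :=
  {σ : Fin (n*(n-1)/2) → Sym2 (Fin n) // Function.Injective σ ∧ ∀ i, ¬ (σ i).IsDiag}

/-- The König process: `KonigProc σ m` is the graph `G_m`, where `G_0 = ⊥` and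
`G_{m+1} = G_m + e_{m+1}` if that graph is König, `G_{m+1} = G_m` otherwise. -/
def KonigProc {n : ℕ} (σ : EdgeOrdering n) : ℕ → SimpleGraph (Fin n)
  | 0 => ⊥
  | m+1 =>
    if h : m < n*(n-1)/2 then
      (if IsKonig (KonigProc σ m ⊔ SimpleGraph.fromEdgeSet {σ.1 ⟨m, h⟩})
        then KonigProc σ m ⊔ SimpleGraph.fromEdgeSet {σ.1 ⟨m, h⟩}
        else KonigProc σ m)
    else KonigProc σ m

/-- The probability of an event `A` under the uniformly random edge ordering. -/
def Pr (n : ℕ) (A : EdgeOrdering n → Prop) : ℝ :=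
  (Nat.card {σ : EdgeOrdering n // A σ} : ℝ) / (Nat.card (EdgeOrdering n) : ℝ)

instance instFiniteEdgeOrdering (n : ℕ) : Finite (EdgeOrdering n) :=
  inferInstanceAs (Finite {σ : Fin (n*(n-1)/2) → Sym2 (Fin n) //
    Function.Injective σ ∧ ∀ i, ¬ (σ i).IsDiag})

instance instFintypeEdgeOrdering (n : ℕ) : Fintype (EdgeOrdering n) := Fintype.ofFinite _

lemma card_not_isDiag (n : ℕ) :
    Fintype.card {e : Sym2 (Fin n) // ¬ e.IsDiag} = n*(n-1)/2 := by
  have := Sym2.card_subtype_not_diag (α := Fin n)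
  rw [Fintype.card_fin, Nat.choose_two_right] at this
  rw [← this]

instance instNonemptyEdgeOrdering (n : ℕ) : Nonempty (EdgeOrdering n) := by
  let φ := (Fintype.equivFinOfCardEq (card_not_isDiag n)).symm
  exact ⟨⟨fun i => (φ i).1, fun i j h => φ.injective (Subtype.ext h), fun i => (φ i).2⟩⟩

/-- Every pair of distinct vertices appears in the ordering. -/
lemma EdgeOrdering.exists_eq {n : ℕ} (σ : EdgeOrdering n) {e : Sym2 (Fin n)} (he : ¬ e.IsDiag) :
    ∃ i, σ.1 i = e := by
  let f : Fin (n*(n-1)/2) → {e : Sym2 (Fin n) // ¬ e.IsDiag} := fun i => ⟨σ.1 i, σ.2.2 i⟩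
  have hf : Function.Injective f := fun i j h => σ.2.1 (congrArg Subtype.val h)
  have hb : Function.Bijective f :=
    (Fintype.bijective_iff_injective_and_card f).2 ⟨hf, by rw [card_not_isDiag, Fintype.card_fin]⟩
  obtain ⟨i, hi⟩ := hb.2 ⟨e, he⟩
  exact ⟨i, congrArg Subtype.val hi⟩

/-! ### Elementary probability for uniformly random orderings -/

lemma Pr_eq {n : ℕ} (A : EdgeOrdering n → Prop) :
    Pr n A = ((Finset.univ.filter A).card : ℝ) / (Fintype.card (EdgeOrdering n) : ℝ) := by
  unfold Pr
  rw [Nat.card_eq_fintype_card, Nat.card_eq_fintype_card, Fintype.card_subtype]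

lemma card_edgeOrdering_pos (n : ℕ) : (0 : ℝ) < Fintype.card (EdgeOrdering n) := by
  exact_mod_cast Fintype.card_pos

lemma Pr_mono {n : ℕ} {A B : EdgeOrdering n → Prop} (h : ∀ σ, A σ → B σ) : Pr n A ≤ Pr n B := by
  rw [Pr_eq, Pr_eq]
  gcongr with σ
  exact h σ

lemma Pr_le_one {n : ℕ} (A : EdgeOrdering n → Prop) : Pr n A ≤ 1 := by
  rw [Pr_eq, div_le_one (card_edgeOrdering_pos n)]
  exact_mod_cast Finset.card_le_univ _

lemma Pr_or_le {n : ℕ} (A B : EdgeOrdering n → Prop) :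
    Pr n (fun σ => A σ ∨ B σ) ≤ Pr n A + Pr n B := by
  rw [Pr_eq, Pr_eq, Pr_eq, ← add_div]
  gcongr
  rw [← Nat.cast_add, Nat.cast_le]
  refine le_trans (Finset.card_le_card fun σ => ?_) (Finset.card_union_le _ _)
  simp

lemma Pr_exists_le {n : ℕ} {ι : Type*} (s : Finset ι) (A : ι → EdgeOrdering n → Prop) :
    Pr n (fun σ => ∃ x ∈ s, A x σ) ≤ ∑ x ∈ s, Pr n (A x) := by
  simp only [Pr_eq]
  rw [← Finset.sum_div]
  gcongr
  rw [← Nat.cast_sum, Nat.cast_le]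
  refine le_trans (Finset.card_le_card fun σ => ?_) Finset.card_biUnion_le
  simp

lemma one_sub_Pr_not_le {n : ℕ} (A : EdgeOrdering n → Prop) :
    1 - Pr n (fun σ => ¬ A σ) ≤ Pr n A := by
  have h1 : (1 : ℝ) = Pr n (fun σ => A σ ∨ ¬ A σ) := by
    rw [Pr_eq]
    simp [em, (card_edgeOrdering_pos n).ne']
  have := Pr_or_le A (fun σ => ¬ A σ)
  linarith

/-! ### Exponential supermartingales along a random ordering -/

/-- Exchange the entries at positions `a` and `b` of an ordering. -/
def EdgeOrdering.swap {n : ℕ} (σ : EdgeOrdering n) (a b : Fin (n*(n-1)/2)) : EdgeOrdering n :=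
  ⟨σ.1 ∘ Equiv.swap a b, σ.2.1.comp (Equiv.swap a b).injective, fun _ => σ.2.2 _⟩

lemma EdgeOrdering.swap_swap {n : ℕ} (σ : EdgeOrdering n) (a b : Fin (n*(n-1)/2)) :
    (σ.swap a b).swap a b = σ := by
  apply Subtype.ext
  funext i
  simp [EdgeOrdering.swap]

lemma EdgeOrdering.swap_apply_of_lt {n : ℕ} (σ : EdgeOrdering n) {a b i : Fin (n*(n-1)/2)}
    (ha : i < a) (hb : i < b) : (σ.swap a b).1 i = σ.1 i := by
  simp [EdgeOrdering.swap, Equiv.swap_apply_of_ne_of_ne ha.ne hb.ne]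

/-- `X m σ` depends only on the first `m` entries of `σ`. -/
def IsAdapted {n : ℕ} {β : Type*} (X : ℕ → EdgeOrdering n → β) : Prop :=
  ∀ (m : ℕ) (σ : EdgeOrdering n) (a b : Fin (n*(n-1)/2)), m ≤ a.val → m ≤ b.val →
    X m (σ.swap a b) = X m σ

/-- The indicator that the `i`-th edge lies in the set `S i σ`. -/
def hit {n : ℕ} (S : ℕ → EdgeOrdering n → Finset (Sym2 (Fin n))) (i : ℕ) (σ : EdgeOrdering n) :
    ℝ :=
  if ∃ h : i < n*(n-1)/2, σ.1 ⟨i, h⟩ ∈ S i σ then 1 else 0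

/-- The conditional probability, given the first `i` edges, that the next one is in `S i σ`. -/
def rate {n : ℕ} (S : ℕ → EdgeOrdering n → Finset (Sym2 (Fin n))) (i : ℕ) (σ : EdgeOrdering n) :
    ℝ :=
  ((Finset.univ.filter fun k : Fin (n*(n-1)/2) => i ≤ k.val ∧ σ.1 k ∈ S i σ).card : ℝ) /
    (((n*(n-1)/2 : ℕ) : ℝ) - i)

lemma hit_swap {n : ℕ} {S : ℕ → EdgeOrdering n → Finset (Sym2 (Fin n))} (hS : IsAdapted S)
    {i : ℕ} (σ : EdgeOrdering n) {a b : Fin (n*(n-1)/2)} (ha : i < a.val) (hb : i < b.val) :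
    hit S i (σ.swap a b) = hit S i σ := by
  unfold hit
  rw [hS i σ a b ha.le hb.le]
  congr 1
  apply propext
  constructor <;> rintro ⟨h, hi⟩ <;> refine ⟨h, ?_⟩
  · rwa [EdgeOrdering.swap_apply_of_lt σ (i := ⟨i, h⟩) ha hb] at hi
  · rwa [EdgeOrdering.swap_apply_of_lt σ (i := ⟨i, h⟩) ha hb]

lemma rate_swap {n : ℕ} {S : ℕ → EdgeOrdering n → Finset (Sym2 (Fin n))} (hS : IsAdapted S)
    {i : ℕ} (σ : EdgeOrdering n) {a b : Fin (n*(n-1)/2)} (ha : i ≤ a.val) (hb : i ≤ b.val) :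
    rate S i (σ.swap a b) = rate S i σ := by
  unfold rate
  rw [hS i σ a b ha hb]
  congr 2
  have hle : ∀ k : Fin (n*(n-1)/2), i ≤ k.val → i ≤ (Equiv.swap a b k).val := by
    intro k hk
    by_cases h1 : k = a
    · subst h1; simpa using hb
    · by_cases h2 : k = b
      · subst h2; simpa using ha
      · rwa [Equiv.swap_apply_of_ne_of_ne h1 h2]
  refine Finset.card_bij (fun k _ => Equiv.swap a b k) ?_ ?_ ?_
  · intro k hk
    simp only [Finset.mem_filter, Finset.mem_univ, true_and] at hk ⊢
    exact ⟨hle k hk.1, hk.2⟩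
  · intro k _ l _ h
    exact (Equiv.swap a b).injective h
  · intro k hk
    simp only [Finset.mem_filter, Finset.mem_univ, true_and] at hk
    refine ⟨Equiv.swap a b k, ?_, by simp⟩
    simp only [Finset.mem_filter, Finset.mem_univ, true_and]
    refine ⟨hle k hk.1, ?_⟩
    simpa [EdgeOrdering.swap] using hk.2

lemma sum_mul_hit_eq {n : ℕ} {S : ℕ → EdgeOrdering n → Finset (Sym2 (Fin n))} (hS : IsAdapted S)
    {m : ℕ} (hm : m < n*(n-1)/2) (f : EdgeOrdering n → ℝ)
    (hf : ∀ σ a b, m ≤ a.val → m ≤ b.val → f (EdgeOrdering.swap σ a b) = f σ) :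
    ∑ σ, f σ * hit S m σ = ∑ σ, f σ * rate S m σ := by
  set P := Finset.univ.filter fun k : Fin (n*(n-1)/2) => m ≤ k.val with hP
  have hPc : (P.card : ℝ) = ((n*(n-1)/2 : ℕ) : ℝ) - m := by
    have : P = Finset.Ici ⟨m, hm⟩ := by
      ext k; simp [hP, Fin.le_def]
    rw [this, Fin.card_Ici, Nat.cast_sub hm.le]
  have hpos : (0 : ℝ) < ((n*(n-1)/2 : ℕ) : ℝ) - m := by
    rw [sub_pos]; exact_mod_cast hm
  have key : ∀ k ∈ P, ∑ σ, f σ * hit S m σ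
      = ∑ σ, f σ * (if σ.1 k ∈ S m σ then (1 : ℝ) else 0) := by
    intro k hk
    have hk' : m ≤ k.val := (Finset.mem_filter.1 hk).2
    let φ : EdgeOrdering n ≃ EdgeOrdering n :=
      { toFun := fun σ => σ.swap ⟨m, hm⟩ k
        invFun := fun σ => σ.swap ⟨m, hm⟩ k
        left_inv := fun σ => σ.swap_swap _ _
        right_inv := fun σ => σ.swap_swap _ _ }
    rw [← Equiv.sum_comp φ]
    refine Finset.sum_congr rfl fun σ _ => ?_
    have h1 : φ σ = σ.swap ⟨m, hm⟩ k := rfl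
    rw [h1, hf σ _ _ le_rfl hk']
    unfold hit
    rw [hS m σ ⟨m, hm⟩ k le_rfl hk']
    have h2 : (σ.swap ⟨m, hm⟩ k).1 ⟨m, hm⟩ = σ.1 k := by simp [EdgeOrdering.swap]
    simp [hm, h2]
  have h3 := Finset.sum_congr (rfl : P = P) key
  rw [Finset.sum_const, nsmul_eq_mul, hPc, Finset.sum_comm] at h3
  rw [← mul_left_cancel_iff_of_pos hpos, h3, Finset.mul_sum]
  refine Finset.sum_congr rfl fun σ _ => ?_
  rw [← Finset.mul_sum, Finset.sum_boole, hP, Finset.filter_filter]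
  unfold rate
  field_simp

/-- The exponential supermartingale attached to the hits of an adapted family of sets. -/
lemma sum_exp_hit_sub_rate_le {n : ℕ} {S : ℕ → EdgeOrdering n → Finset (Sym2 (Fin n))}
    (hS : IsAdapted S) (l : ℝ) (T : ℕ) (hT : T ≤ n*(n-1)/2) :
    ∑ σ, Real.exp (∑ i ∈ Finset.range T, (l * hit S i σ - (Real.exp l - 1) * rate S i σ))
      ≤ Fintype.card (EdgeOrdering n) := by
  induction T with
  | zero => simp
  | succ T ih =>
    refine le_trans ?_ (ih (by omega))
    set Z : EdgeOrdering n → ℝ := fun σ =>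
      ∑ i ∈ Finset.range T, (l * hit S i σ - (Real.exp l - 1) * rate S i σ) with hZ
    set f : EdgeOrdering n → ℝ := fun σ => Real.exp (Z σ - (Real.exp l - 1) * rate S T σ) with hf
    have hfs : ∀ σ a b, T ≤ a.val → T ≤ b.val → f (EdgeOrdering.swap σ a b) = f σ := by
      intro σ a b ha hb
      simp only [hf, hZ]
      rw [rate_swap hS σ ha hb]
      congr 2
      refine Finset.sum_congr rfl fun i hi => ?_
      have hi' := Finset.mem_range.1 hi
      rw [rate_swap hS σ (by omega) (by omega), hit_swap hS σ (by omega) (by omega)]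
    have h1 : ∀ σ, Real.exp (∑ i ∈ Finset.range (T+1),
        (l * hit S i σ - (Real.exp l - 1) * rate S i σ))
        = f σ + (Real.exp l - 1) * (f σ * hit S T σ) := by
      intro σ
      rw [Finset.sum_range_succ]
      have : Z σ + (l * hit S T σ - (Real.exp l - 1) * rate S T σ)
        = (Z σ - (Real.exp l - 1) * rate S T σ) + l * hit S T σ := by ring
      change Real.exp (Z σ + _) = _
      rw [this, Real.exp_add]
      change f σ * _ = _
      unfold hit
      split_ifs
      · rw [mul_one]; ring
      · simp
    rw [Finset.sum_congr rfl fun σ _ => h1 σ, Finset.sum_add_distrib, ← Finset.mul_sum,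
      sum_mul_hit_eq hS (by omega) f hfs, Finset.mul_sum, ← Finset.sum_add_distrib]
    refine Finset.sum_le_sum fun σ _ => ?_
    have h2 : Real.exp (Z σ) = f σ * Real.exp ((Real.exp l - 1) * rate S T σ) := by
      simp only [hf]; rw [← Real.exp_add]; congr 1; ring
    rw [h2]
    have h3 := Real.add_one_le_exp ((Real.exp l - 1) * rate S T σ)
    have h4 : 0 < f σ := Real.exp_pos _
    nlinarith

lemma Pr_le_exp_of_hit_sub_rate {n : ℕ} {S : ℕ → EdgeOrdering n → Finset (Sym2 (Fin n))}
    (hS : IsAdapted S) (l c : ℝ) (T : ℕ) (hT : T ≤ n*(n-1)/2) :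
    Pr n (fun σ => c ≤ l * (∑ i ∈ Finset.range T, hit S i σ)
      - (Real.exp l - 1) * ∑ i ∈ Finset.range T, rate S i σ) ≤ Real.exp (-c) := by
  rw [Pr_eq, div_le_iff₀ (card_edgeOrdering_pos n)]
  have h := sum_exp_hit_sub_rate_le hS l T hT
  have h2 : ∑ σ ∈ Finset.univ.filter (fun σ => c ≤ l * (∑ i ∈ Finset.range T, hit S i σ)
      - (Real.exp l - 1) * ∑ i ∈ Finset.range T, rate S i σ), Real.exp c
      ≤ Fintype.card (EdgeOrdering n) := by
    refine le_trans ?_ h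
    refine le_trans (Finset.sum_le_sum fun σ hσ => ?_)
      (Finset.sum_le_sum_of_subset_of_nonneg (Finset.filter_subset _ _)
        fun _ _ _ => (Real.exp_pos _).le)
    rw [Finset.sum_sub_distrib, ← Finset.mul_sum, ← Finset.mul_sum]
    exact Real.exp_le_exp.2 (Finset.mem_filter.1 hσ).2
  rw [Finset.sum_const, nsmul_eq_mul] at h2
  rw [Real.exp_neg, inv_mul_eq_div, le_div_iff₀ (Real.exp_pos c)]
  exact h2

/-- Few hits are unlikely when the accumulated rate is large. -/
lemma Pr_hit_le_of_le_rate {n : ℕ} {S : ℕ → EdgeOrdering n → Finset (Sym2 (Fin n))}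
    (hS : IsAdapted S) (a b : ℝ) (ha : 0 ≤ a) (T : ℕ) (hT : T ≤ n*(n-1)/2) :
    Pr n (fun σ => a ≤ ∑ i ∈ Finset.range T, rate S i σ ∧
      ∑ i ∈ Finset.range T, hit S i σ ≤ b) ≤ Real.exp (b - a / 2) := by
  have h := Pr_le_exp_of_hit_sub_rate hS (-1) (a / 2 - b) T hT
  rw [neg_sub] at h
  refine le_trans (Pr_mono fun σ hσ => ?_) h
  have h1 : Real.exp (-1) ≤ 1 / 2 := by
    have := Real.exp_neg_one_lt_d9; linarith
  nlinarith [hσ.1, hσ.2]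

/-- Many hits are unlikely when the accumulated rate is small. -/
lemma Pr_le_hit_of_rate_le {n : ℕ} {S : ℕ → EdgeOrdering n → Finset (Sym2 (Fin n))}
    (hS : IsAdapted S) (a b : ℝ) (ha : 0 ≤ a) (T : ℕ) (hT : T ≤ n*(n-1)/2) :
    Pr n (fun σ => ∑ i ∈ Finset.range T, rate S i σ ≤ a ∧
      b ≤ ∑ i ∈ Finset.range T, hit S i σ) ≤ Real.exp (2 * a - b) := by
  have h := Pr_le_exp_of_hit_sub_rate hS 1 (b - 2 * a) T hT
  rw [neg_sub] at h
  refine le_trans (Pr_mono fun σ hσ => ?_) h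
  have h1 : Real.exp 1 ≤ 3 := by
    have := Real.exp_one_lt_d9; linarith
  have h2 : 1 ≤ Real.exp 1 := Real.one_le_exp (by norm_num)
  nlinarith [hσ.1, hσ.2]

/-! ### Matchings and covers in König graphs -/

lemma IsMatchingOn.card_le_matchNum {n : ℕ} {G : SimpleGraph (Fin n)}
    {M : Finset (Sym2 (Fin n))} (h : IsMatchingOn G M) : M.card ≤ matchNum G := by
  refine le_csSup ⟨Fintype.card (Sym2 (Fin n)), ?_⟩ ⟨M, h, rfl⟩
  rintro _ ⟨M', -, rfl⟩
  exact Finset.card_le_univ _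

lemma exists_isMatchingOn_card_eq {n : ℕ} (G : SimpleGraph (Fin n)) :
    ∃ M, IsMatchingOn G M ∧ M.card = matchNum G := by
  have : matchNum G ∈ {k | ∃ M : Finset (Sym2 (Fin n)), IsMatchingOn G M ∧ M.card = k} := by
    refine Nat.sSup_mem ⟨0, ∅, ⟨by simp, by simp⟩, rfl⟩ ⟨Fintype.card (Sym2 (Fin n)), ?_⟩
    rintro _ ⟨M', -, rfl⟩
    exact Finset.card_le_univ _
  exact this

lemma IsVertexCover.coverNum_le_card {n : ℕ} {G : SimpleGraph (Fin n)} {C : Finset (Fin n)}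
    (h : IsVertexCover G C) : coverNum G ≤ C.card :=
  Nat.sInf_le ⟨C, h, rfl⟩

lemma exists_isVertexCover_card_eq {n : ℕ} (G : SimpleGraph (Fin n)) :
    ∃ C, IsVertexCover G C ∧ C.card = coverNum G := by
  have : coverNum G ∈ {k | ∃ C : Finset (Fin n), IsVertexCover G C ∧ C.card = k} := by
    refine Nat.sInf_mem ⟨Finset.univ.card, Finset.univ, ?_, rfl⟩
    intro e _
    induction e using Sym2.ind with
    | _ x y => exact ⟨x, Finset.mem_univ _, by simp⟩
  exact this

lemma exists_choice_of_isVertexCover {n : ℕ} {G : SimpleGraph (Fin n)}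
    {M : Finset (Sym2 (Fin n))} {C : Finset (Fin n)} (hM : IsMatchingOn G M)
    (hC : IsVertexCover G C) :
    ∃ f : Sym2 (Fin n) → Fin n, (∀ e ∈ M, f e ∈ C ∧ f e ∈ e) ∧ Set.InjOn f M := by
  have h : ∀ e, ∃ v, e ∈ M → v ∈ C ∧ v ∈ e := by
    intro e
    by_cases he : e ∈ M
    · obtain ⟨v, h1, h2⟩ := hC e (hM.1 e he)
      exact ⟨v, fun _ => ⟨h1, h2⟩⟩
    · exact ⟨(Quot.out e).1, fun h => absurd h he⟩
  choose f hf using h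
  refine ⟨f, hf, fun e he e' he' hee => ?_⟩
  by_contra hne
  exact hM.2 e he e' he' hne (f e) (hf e he).2 (hee ▸ (hf e' he').2)

lemma matching_card_le_cover_card {n : ℕ} {G : SimpleGraph (Fin n)}
    {M : Finset (Sym2 (Fin n))} {C : Finset (Fin n)} (hM : IsMatchingOn G M)
    (hC : IsVertexCover G C) : M.card ≤ C.card := by
  obtain ⟨f, hf, hinj⟩ := exists_choice_of_isVertexCover hM hC
  exact Finset.card_le_card_of_injOn f (fun e he => (hf e he).1) hinj

lemma matchNum_le_coverNum {n : ℕ} (G : SimpleGraph (Fin n)) : matchNum G ≤ coverNum G := by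
  obtain ⟨M, hM, hM'⟩ := exists_isMatchingOn_card_eq G
  obtain ⟨C, hC, hC'⟩ := exists_isVertexCover_card_eq G
  rw [← hM', ← hC']
  exact matching_card_le_cover_card hM hC

lemma IsVertexCover.anti {n : ℕ} {G H : SimpleGraph (Fin n)} (hGH : G ≤ H)
    {C : Finset (Fin n)} (h : IsVertexCover H C) : IsVertexCover G C :=
  fun e he => h e (SimpleGraph.edgeSet_mono hGH he)

lemma matchNum_mono {n : ℕ} {G H : SimpleGraph (Fin n)} (hGH : G ≤ H) :
    matchNum G ≤ matchNum H := by
  obtain ⟨M, hM, hM'⟩ := exists_isMatchingOn_card_eq G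
  rw [← hM']
  exact IsMatchingOn.card_le_matchNum
    ⟨fun e he => SimpleGraph.edgeSet_mono hGH (hM.1 e he), hM.2⟩

/-- `π` matches every vertex of `C` to a distinct neighbour outside `C`. -/
def MatchesOut {n : ℕ} (G : SimpleGraph (Fin n)) (C : Finset (Fin n)) (π : Fin n → Fin n) :
    Prop :=
  (∀ c ∈ C, G.Adj c (π c) ∧ π c ∉ C) ∧ Set.InjOn π C

lemma exists_matchesOut {n : ℕ} {G : SimpleGraph (Fin n)} {M : Finset (Sym2 (Fin n))}
    {C : Finset (Fin n)} (hM : IsMatchingOn G M) (hC : IsVertexCover G C)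
    (hcard : M.card = C.card) : ∃ π, MatchesOut G C π := by
  obtain ⟨f, hf, hinj⟩ := exists_choice_of_isVertexCover hM hC
  have himg : M.image f = C := by
    refine Finset.eq_of_subset_of_card_le ?_ ?_
    · intro v hv
      obtain ⟨e, he, rfl⟩ := Finset.mem_image.1 hv
      exact (hf e he).1
    · rw [Finset.card_image_of_injOn hinj, hcard]
  have huniq : ∀ e ∈ M, ∀ e' ∈ M, ∀ v, v ∈ e → v ∈ e' → e = e' := by
    intro e he e' he' v hv hv'
    by_contra hne
    exact hM.2 e he e' he' hne v hv hv'
  have hex : ∀ c, ∃ w, c ∈ C → s(c, w) ∈ M ∧ f s(c, w) = c := by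
    intro c
    by_cases hc : c ∈ C
    · rw [← himg] at hc
      obtain ⟨e, he, hfe⟩ := Finset.mem_image.1 hc
      have hce : c ∈ e := hfe ▸ (hf e he).2
      obtain ⟨w, rfl⟩ := Sym2.mem_iff_exists.1 hce
      exact ⟨w, fun _ => ⟨he, hfe⟩⟩
    · exact ⟨c, fun h => absurd h hc⟩
  choose π hπ using hex
  have hadj : ∀ c ∈ C, G.Adj c (π c) := fun c hc => by
    simpa using hM.1 _ (hπ c hc).1
  refine ⟨π, fun c hc => ⟨hadj c hc, fun hc' => ?_⟩, fun c hc c' hc' h => ?_⟩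
  · have h1 := huniq _ (hπ c hc).1 _ (hπ _ hc').1 (π c) (by simp) (by simp)
    have h2 := (hπ c hc).2
    rw [h1, (hπ _ hc').2] at h2
    exact (hadj c hc).ne h2.symm
  · have h1 := huniq _ (hπ c hc).1 _ (hπ c' hc').1 (π c) (by simp) (by simp [h])
    rw [← (hπ c hc).2, h1, (hπ c' hc').2]

lemma IsKonig.exists_matchesOut {n : ℕ} {G : SimpleGraph (Fin n)} (hG : IsKonig G)
    {C : Finset (Fin n)} (hC : IsVertexCover G C) (hcard : C.card = coverNum G) :
    ∃ π, MatchesOut G C π := by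
  obtain ⟨M, hM, hM'⟩ := exists_isMatchingOn_card_eq G
  exact _root_.exists_matchesOut hM hC (by rw [hM', hcard]; exact hG)

lemma MatchesOut.card_image {n : ℕ} {G : SimpleGraph (Fin n)} {C : Finset (Fin n)}
    {π : Fin n → Fin n} (h : MatchesOut G C π) : (C.image π).card = C.card :=
  Finset.card_image_of_injOn h.2

lemma MatchesOut.disjoint {n : ℕ} {G : SimpleGraph (Fin n)} {C : Finset (Fin n)}
    {π : Fin n → Fin n} (h : MatchesOut G C π) : Disjoint C (C.image π) := by
  rw [Finset.disjoint_right]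
  intro v hv
  obtain ⟨c, hc, rfl⟩ := Finset.mem_image.1 hv
  exact (h.1 c hc).2

lemma IsKonig.two_mul_matchNum_le {n : ℕ} {G : SimpleGraph (Fin n)} (hG : IsKonig G) :
    2 * matchNum G ≤ n := by
  obtain ⟨C, hC, hC'⟩ := exists_isVertexCover_card_eq G
  obtain ⟨π, hπ⟩ := hG.exists_matchesOut hC hC'
  have h := Finset.card_le_univ (C ∪ C.image π)
  rw [Finset.card_union_of_disjoint hπ.disjoint, hπ.card_image, hC', Fintype.card_fin, ← hG] at h
  omega

lemma MatchesOut.card_lt_matchNum {n : ℕ} {G : SimpleGraph (Fin n)} {C : Finset (Fin n)}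
    {π : Fin n → Fin n} (h : MatchesOut G C π) {u v : Fin n} (huv : u ≠ v) (hu : u ∉ C)
    (hv : v ∉ C) (hu' : u ∉ C.image π) (hv' : v ∉ C.image π) :
    C.card < matchNum (G ⊔ SimpleGraph.fromEdgeSet {s(u, v)}) := by
  set M := C.image fun c => s(c, π c) with hM
  have hmem : ∀ e ∈ M, ∀ w ∈ e, w ∈ C ∨ w ∈ C.image π := by
    intro e he w hw
    obtain ⟨c, hc, rfl⟩ := Finset.mem_image.1 he
    rcases Sym2.mem_iff.1 hw with rfl | rfl
    · exact Or.inl hc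
    · exact Or.inr (Finset.mem_image_of_mem _ hc)
  have hnot : s(u, v) ∉ M := fun hin => by
    rcases hmem _ hin u (by simp) with h1 | h1
    · exact hu h1
    · exact hu' h1
  have huv' : ∀ w ∈ s(u, v), w ∉ C ∧ w ∉ C.image π := by
    intro w hw
    rcases Sym2.mem_iff.1 hw with rfl | rfl
    · exact ⟨hu, hu'⟩
    · exact ⟨hv, hv'⟩
  have hcard : M.card = C.card := by
    refine Finset.card_image_of_injOn fun c hc c' hc' hcc => ?_
    rcases Sym2.eq_iff.1 hcc with h1 | h1
    · exact h1.1
    · exact absurd (h1.1 ▸ hc) (h.1 c' hc').2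
  have hmatch : IsMatchingOn (G ⊔ SimpleGraph.fromEdgeSet {s(u, v)}) (insert s(u, v) M) := by
    constructor
    · intro e he
      rcases Finset.mem_insert.1 he with rfl | he
      · simp [huv]
      · obtain ⟨c, hc, rfl⟩ := Finset.mem_image.1 he
        have := (h.1 c hc).1
        simp [this]
    · intro e he f hf hef w hwe hwf
      rcases Finset.mem_insert.1 he with rfl | he <;> rcases Finset.mem_insert.1 hf with rfl | hf
      · exact hef rfl
      · rcases hmem f hf w hwf with h1 | h1
        · exact (huv' w hwe).1 h1
        · exact (huv' w hwe).2 h1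
      · rcases hmem e he w hwe with h1 | h1
        · exact (huv' w hwf).1 h1
        · exact (huv' w hwf).2 h1
      · obtain ⟨c, hc, rfl⟩ := Finset.mem_image.1 he
        obtain ⟨c', hc', rfl⟩ := Finset.mem_image.1 hf
        apply hef
        rcases Sym2.mem_iff.1 hwe with h1 | h1 <;> rcases Sym2.mem_iff.1 hwf with h2 | h2
        · rw [← h1, ← h2]
        · exact absurd (h1 ▸ hc) (h2 ▸ (h.1 c' hc').2)
        · exact absurd (h2 ▸ hc') (h1 ▸ (h.1 c hc).2)
        · have := h.2 hc hc' (h1.symm.trans h2)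
          rw [this]
  have := hmatch.card_le_matchNum
  rw [Finset.card_insert_of_notMem hnot, hcard] at this
  omega

/-- Alternating closure: a set of unmatched vertices extends to a set `W ∪ π(B)` whose
neighbours in `C` lie in `B`, and each of whose members can be left unmatched. -/
lemma MatchesOut.exists_closed {n : ℕ} {G : SimpleGraph (Fin n)} {C : Finset (Fin n)}
    {π : Fin n → Fin n} (h : MatchesOut G C π) (W : Finset (Fin n))
    (hW : ∀ w ∈ W, w ∉ C ∧ w ∉ C.image π) :
    ∃ B ⊆ C, (∀ x ∈ W ∪ B.image π, ∀ c ∈ C, G.Adj x c → c ∈ B) ∧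
      ∀ x ∈ W ∪ B.image π, ∃ π', MatchesOut G C π' ∧ C.image π' ⊆ C.image π ∪ W ∧
        x ∉ C.image π' := by
  set Q : Finset (Fin n) → Prop := fun B => B ⊆ C ∧ ∀ x ∈ W ∪ B.image π, ∃ π',
    MatchesOut G C π' ∧ C.image π' ⊆ C.image π ∪ W ∧ x ∉ C.image π' ∧
      ∀ c ∈ C, c ∉ B → π' c = π c with hQ
  have hne : (Finset.univ.filter Q).Nonempty := by
    refine ⟨∅, ?_⟩
    simp only [Finset.mem_filter, Finset.mem_univ, true_and]
    refine ⟨by simp, fun x hx => ⟨π, h, Finset.subset_union_left, ?_, fun _ _ _ => rfl⟩⟩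
    simp only [Finset.image_empty, Finset.union_empty] at hx
    exact (hW x hx).2
  obtain ⟨B, hB, hmax⟩ := Finset.exists_max_image _ Finset.card hne
  obtain ⟨hBC, hBQ⟩ := (Finset.mem_filter.1 hB).2
  refine ⟨B, hBC, ?_, fun x hx => ?_⟩
  · intro x hx c hc hxc
    by_contra hcB
    have hxC : x ∉ C := by
      rcases Finset.mem_union.1 hx with h1 | h1
      · exact (hW x h1).1
      · obtain ⟨b, hb, rfl⟩ := Finset.mem_image.1 h1
        exact (h.1 b (hBC hb)).2
    have hxP : x ∈ C.image π ∪ W := by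
      rcases Finset.mem_union.1 hx with h1 | h1
      · exact Finset.mem_union_right _ h1
      · exact Finset.mem_union_left _ (Finset.image_subset_image hBC h1)
    obtain ⟨π', h1, h2, h3, h4⟩ := hBQ x hx
    have h3' : ∀ a ∈ C, π' a ≠ x := fun a ha hax => h3 (Finset.mem_image.2 ⟨a, ha, hax⟩)
    have hins : Q (insert c B) := by
      refine ⟨Finset.insert_subset hc hBC, fun y hy => ?_⟩
      by_cases hyB : y ∈ W ∪ B.image π
      · obtain ⟨ρ, g1, g2, g3, g4⟩ := hBQ y hyB
        exact ⟨ρ, g1, g2, g3, fun a ha hab => g4 a ha fun hh => hab (Finset.mem_insert_of_mem hh)⟩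
      · have hyc : y = π c := by
          rw [Finset.image_insert, Finset.mem_union, Finset.mem_insert] at hy
          rw [Finset.mem_union] at hyB
          tauto
        subst hyc
        refine ⟨Function.update π' c x, ⟨?_, ?_⟩, ?_, ?_, ?_⟩
        · intro a ha
          by_cases hac : a = c
          · subst hac
            simpa using ⟨hxc.symm, hxC⟩
          · simpa [hac] using h1.1 a ha
        · intro a ha b hb hab
          by_cases hac : a = c <;> by_cases hbc : b = c
          · rw [hac, hbc]
          · subst hac
            simp only [Function.update_self, Function.update_of_ne hbc] at hab
            exact absurd hab.symm (h3' b hb)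
          · subst hbc
            simp only [Function.update_self, Function.update_of_ne hac] at hab
            exact absurd hab (h3' a ha)
          · simp only [Function.update_of_ne hbc, Function.update_of_ne hac] at hab
            exact h1.2 ha hb hab
        · intro z hz
          obtain ⟨a, ha, rfl⟩ := Finset.mem_image.1 hz
          by_cases hac : a = c
          · subst hac; simpa using hxP
          · rw [Function.update_of_ne hac]
            exact h2 (Finset.mem_image_of_mem _ ha)
        · intro hz
          obtain ⟨a, ha, haz⟩ := Finset.mem_image.1 hz
          by_cases hac : a = c
          · subst hac
            rw [Function.update_self] at haz
            exact hyB (haz ▸ hx)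
          · rw [Function.update_of_ne hac, ← h4 c hc hcB] at haz
            exact hac (h1.2 ha hc haz)
        · intro a ha hab
          rw [Finset.mem_insert, not_or] at hab
          rw [Function.update_of_ne hab.1]
          exact h4 a ha hab.2
    have := hmax (insert c B) (Finset.mem_filter.2 ⟨Finset.mem_univ _, hins⟩)
    rw [Finset.card_insert_of_notMem hcB] at this
    omega
  · obtain ⟨π', h1, h2, h3, -⟩ := hBQ x hx
    exact ⟨π', h1, h2, h3⟩

/-- In a König graph with an expansion property, many pairs enlarge the matching number. -/
lemma IsKonig.exists_many_augmenting {n : ℕ} {G : SimpleGraph (Fin n)} (hG : IsKonig G) (L : ℕ)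
    (hd : 2 * matchNum G + 2 ≤ n)
    (hexp : ∀ D A : Finset (Fin n), D.card = A.card → n - 2 * matchNum G - 1 ≤ D.card →
      D.card ≤ L → ¬ ∀ x ∈ D, ∀ y, G.Adj x y → y ∈ A) :
    ∃ (X : Finset (Fin n)) (Y : Fin n → Finset (Fin n)), L < X.card ∧ ∀ u ∈ X, L < (Y u).card ∧
      ∀ v ∈ Y u, u ≠ v ∧ matchNum G < matchNum (G ⊔ SimpleGraph.fromEdgeSet {s(u, v)}) := by
  obtain ⟨C, hC, hC'⟩ := exists_isVertexCover_card_eq G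
  have hCm : C.card = matchNum G := hC'.trans hG.symm
  obtain ⟨π, hπ⟩ := hG.exists_matchesOut hC hC'
  have large : ∀ (ρ : Fin n → Fin n) (W : Finset (Fin n)), MatchesOut G C ρ →
      (∀ w ∈ W, w ∉ C ∧ w ∉ C.image ρ) → n - 2 * matchNum G - 1 ≤ W.card →
      ∀ B ⊆ C, (∀ x ∈ W ∪ B.image ρ, ∀ c ∈ C, G.Adj x c → c ∈ B) →
      L < (W ∪ B.image ρ).card := by
    intro ρ W hρ hW hWc B hBC hB
    by_contra hlt
    have hle : B.card ≤ (W ∪ B.image ρ).card := by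
      calc B.card = (B.image ρ).card :=
            (Finset.card_image_of_injOn (hρ.2.mono (by exact_mod_cast hBC))).symm
        _ ≤ _ := Finset.card_le_card Finset.subset_union_right
    obtain ⟨A, hBA, hAc⟩ := Finset.exists_superset_card_eq hle (Finset.card_le_univ _)
    refine hexp _ A hAc.symm (hWc.trans (Finset.card_le_card Finset.subset_union_left))
      (not_lt.1 hlt) fun x hx y hxy => hBA (hB x hx y ?_ hxy)
    have hxC : x ∉ C := by
      rcases Finset.mem_union.1 hx with h1 | h1
      · exact (hW x h1).1
      · obtain ⟨b, hb, rfl⟩ := Finset.mem_image.1 h1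
        exact (hρ.1 b (hBC hb)).2
    obtain ⟨v, hv, hve⟩ := hC s(x, y) (by simpa using hxy)
    rcases Sym2.mem_iff.1 hve with rfl | rfl
    · exact absurd hv hxC
    · exact hv
  have hcompl : ∀ ρ, MatchesOut G C ρ →
      (Finset.univ \ (C ∪ C.image ρ)).card = n - 2 * matchNum G := by
    intro ρ hρ
    rw [Finset.card_sdiff_of_subset (Finset.subset_univ _),
      Finset.card_union_of_disjoint hρ.disjoint, hρ.card_image, hCm, Finset.card_univ,
      Fintype.card_fin]
    omega
  have hmemc : ∀ ρ w, w ∈ Finset.univ \ (C ∪ C.image ρ) → w ∉ C ∧ w ∉ C.image ρ := by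
    intro ρ w hw
    simpa [not_or] using hw
  obtain ⟨B, hBC, hB1, hB2⟩ := hπ.exists_closed _ (hmemc π)
  have hY : ∀ u, ∃ Yu : Finset (Fin n), u ∈ (Finset.univ \ (C ∪ C.image π)) ∪ B.image π →
      L < Yu.card ∧ ∀ v ∈ Yu, u ≠ v ∧
        matchNum G < matchNum (G ⊔ SimpleGraph.fromEdgeSet {s(u, v)}) := by
    intro u
    by_cases hu : u ∈ (Finset.univ \ (C ∪ C.image π)) ∪ B.image π
    swap
    · exact ⟨∅, fun h => absurd h hu⟩
    obtain ⟨ρ, hρ, -, hρu⟩ := hB2 u hu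
    have huC : u ∉ C := by
      rcases Finset.mem_union.1 hu with h1 | h1
      · exact (hmemc π u h1).1
      · obtain ⟨b, hb, rfl⟩ := Finset.mem_image.1 h1
        exact (hπ.1 b (hBC hb)).2
    set W := (Finset.univ \ (C ∪ C.image ρ)).erase u with hWdef
    have hW : ∀ w ∈ W, w ∉ C ∧ w ∉ C.image ρ := fun w hw => hmemc ρ w (Finset.mem_of_mem_erase hw)
    have huW : u ∈ Finset.univ \ (C ∪ C.image ρ) := by
      rw [Finset.mem_sdiff, Finset.mem_union]
      exact ⟨Finset.mem_univ _, fun h => h.elim huC hρu⟩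
    obtain ⟨B', hBC', hB1', hB2'⟩ := hρ.exists_closed W hW
    refine ⟨W ∪ B'.image ρ, fun _ => ⟨large ρ W hρ hW ?_ B' hBC' hB1', fun v hv => ?_⟩⟩
    · rw [hWdef, Finset.card_erase_of_mem huW, hcompl ρ hρ]
    · obtain ⟨ρ', hρ', hsub, hρv⟩ := hB2' v hv
      have huv : u ≠ v := by
        rintro rfl
        rcases Finset.mem_union.1 hv with h1 | h1
        · exact absurd rfl (Finset.ne_of_mem_erase h1)
        · exact hρu (Finset.image_subset_image hBC' h1)
      have hvC : v ∉ C := by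
        rcases Finset.mem_union.1 hv with h1 | h1
        · exact (hW v h1).1
        · obtain ⟨b, hb, rfl⟩ := Finset.mem_image.1 h1
          exact (hρ.1 b (hBC' hb)).2
      have hρu' : u ∉ C.image ρ' := by
        intro h1
        rcases Finset.mem_union.1 (hsub h1) with h2 | h2
        · exact hρu h2
        · exact absurd rfl (Finset.ne_of_mem_erase h2)
      refine ⟨huv, ?_⟩
      rw [← hCm]
      exact hρ'.card_lt_matchNum huv huC hvC hρu' hρv
  choose Y hY using hY
  exact ⟨_, Y, large π _ hπ (hmemc π) (by rw [hcompl π hπ]; omega) B hBC hB1, hY⟩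

/-! ### The process -/

/-- The vertices contained in at least one minimum vertex cover. -/
def canCover {n : ℕ} (G : SimpleGraph (Fin n)) : Finset (Fin n) :=
  Finset.univ.filter fun v => ∃ C, IsVertexCover G C ∧ C.card = coverNum G ∧ v ∈ C

lemma matchNum_le_card_canCover {n : ℕ} (G : SimpleGraph (Fin n)) :
    matchNum G ≤ (canCover G).card := by
  obtain ⟨C, hC, hC'⟩ := exists_isVertexCover_card_eq G
  refine (matchNum_le_coverNum G).trans (hC' ▸ Finset.card_le_card fun v hv => ?_)
  exact Finset.mem_filter.2 ⟨Finset.mem_univ _, C, hC, hC', hv⟩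

lemma isKonig_bot (n : ℕ) : IsKonig (⊥ : SimpleGraph (Fin n)) := by
  have h : coverNum (⊥ : SimpleGraph (Fin n)) ≤ (∅ : Finset (Fin n)).card :=
    IsVertexCover.coverNum_le_card fun e he => by simp at he
  have := matchNum_le_coverNum (⊥ : SimpleGraph (Fin n))
  simp only [Finset.card_empty] at h
  unfold IsKonig
  omega

lemma IsVertexCover.sup_fromEdgeSet {n : ℕ} {G : SimpleGraph (Fin n)} {C : Finset (Fin n)}
    (hC : IsVertexCover G C) {e : Sym2 (Fin n)} {v : Fin n} (hv : v ∈ C) (hve : v ∈ e) :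
    IsVertexCover (G ⊔ SimpleGraph.fromEdgeSet {e}) C := by
  intro f hf
  rw [SimpleGraph.edgeSet_sup, Set.mem_union] at hf
  rcases hf with hf | hf
  · exact hC f hf
  · rw [SimpleGraph.edgeSet_fromEdgeSet] at hf
    have : f = e := hf.1
    exact ⟨v, hv, this ▸ hve⟩

lemma IsKonig.sup_of_mem_canCover {n : ℕ} {G : SimpleGraph (Fin n)} (hG : IsKonig G)
    {e : Sym2 (Fin n)} {v : Fin n} (hv : v ∈ canCover G) (hve : v ∈ e) :
    IsKonig (G ⊔ SimpleGraph.fromEdgeSet {e}) := by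
  obtain ⟨C, hC, hC', hvC⟩ := (Finset.mem_filter.1 hv).2
  have h1 := (hC.sup_fromEdgeSet hvC hve).coverNum_le_card
  have h2 := matchNum_le_coverNum (G ⊔ SimpleGraph.fromEdgeSet {e})
  have h3 := matchNum_mono (le_sup_left : G ≤ G ⊔ SimpleGraph.fromEdgeSet {e})
  unfold IsKonig at *
  omega

lemma IsKonig.sup_of_matchNum_lt {n : ℕ} {G : SimpleGraph (Fin n)} (hG : IsKonig G)
    {e : Sym2 (Fin n)} (h : matchNum G < matchNum (G ⊔ SimpleGraph.fromEdgeSet {e})) :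
    IsKonig (G ⊔ SimpleGraph.fromEdgeSet {e}) := by
  obtain ⟨C, hC, hC'⟩ := exists_isVertexCover_card_eq G
  have hins : IsVertexCover G (insert (Quot.out e).1 C) := fun f hf => by
    obtain ⟨v, hv, hvf⟩ := hC f hf
    exact ⟨v, Finset.mem_insert_of_mem hv, hvf⟩
  have h1 := (hins.sup_fromEdgeSet (Finset.mem_insert_self _ _)
    (Sym2.out_fst_mem e)).coverNum_le_card
  have h2 := matchNum_le_coverNum (G ⊔ SimpleGraph.fromEdgeSet {e})
  have h3 := Finset.card_insert_le (Quot.out e).1 C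
  unfold IsKonig at *
  omega

lemma konigProc_isKonig {n : ℕ} (σ : EdgeOrdering n) (m : ℕ) : IsKonig (KonigProc σ m) := by
  induction m with
  | zero => exact isKonig_bot n
  | succ m ih =>
    rw [KonigProc]
    split_ifs with h1 h2
    · exact h2
    · exact ih
    · exact ih

lemma konigProc_mono {n : ℕ} (σ : EdgeOrdering n) : Monotone (KonigProc σ) := by
  refine monotone_nat_of_le_succ fun m => ?_
  rw [KonigProc.eq_def σ (m + 1)]
  dsimp only
  split_ifs
  · exact le_sup_left
  · exact le_rfl
  · exact le_rfl

lemma konigProc_succ_of_isKonig {n : ℕ} (σ : EdgeOrdering n) {m : ℕ} (h : m < n*(n-1)/2)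
    (hK : IsKonig (KonigProc σ m ⊔ SimpleGraph.fromEdgeSet {σ.1 ⟨m, h⟩})) :
    KonigProc σ (m + 1) = KonigProc σ m ⊔ SimpleGraph.fromEdgeSet {σ.1 ⟨m, h⟩} := by
  rw [KonigProc, dif_pos h, if_pos hK]

lemma konigProc_isAdapted {n : ℕ} : IsAdapted fun m (σ : EdgeOrdering n) => KonigProc σ m := by
  intro m σ a b
  induction m with
  | zero => intros; rfl
  | succ m ih =>
    intro ha hb
    have ih' := ih (by omega) (by omega)
    dsimp only at ih' ⊢
    by_cases h : m < n*(n-1)/2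
    · have h1 : (σ.swap a b).1 ⟨m, h⟩ = σ.1 ⟨m, h⟩ :=
        σ.swap_apply_of_lt (i := ⟨m, h⟩) ha hb
      rw [KonigProc, KonigProc, dif_pos h, dif_pos h, ih', h1]
    · rw [KonigProc, KonigProc, dif_neg h, dif_neg h, ih']

lemma IsAdapted.comp {n : ℕ} {β γ : Type*} {X : ℕ → EdgeOrdering n → β} (hX : IsAdapted X)
    (F : β → γ) : IsAdapted fun m σ => F (X m σ) :=
  fun m σ a b ha hb => congrArg F (hX m σ a b ha hb)

lemma konigProc_accepts {n : ℕ} (σ : EdgeOrdering n) (i : Fin (n*(n-1)/2)) {v : Fin n}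
    (hv : v ∈ canCover (KonigProc σ i)) (hve : v ∈ σ.1 i) {m : ℕ} (hm : i.val < m) :
    σ.1 i ∈ (KonigProc σ m).edgeSet := by
  have h := konigProc_succ_of_isKonig σ i.2
    ((konigProc_isKonig σ i).sup_of_mem_canCover hv hve)
  refine SimpleGraph.edgeSet_mono (konigProc_mono σ (Nat.succ_le_of_lt hm)) ?_
  rw [Nat.succ_eq_add_one, h, SimpleGraph.edgeSet_sup, SimpleGraph.edgeSet_fromEdgeSet]
  exact Or.inr ⟨rfl, σ.2.2 i⟩

/-! ### Counting hits and bounding rates -/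

lemma sum_hit_eq_card {n : ℕ} (S : ℕ → EdgeOrdering n → Finset (Sym2 (Fin n)))
    (σ : EdgeOrdering n) (T : ℕ) :
    ∑ i ∈ Finset.range T, hit S i σ =
      ((Finset.univ.filter fun k : Fin (n*(n-1)/2) => k.val < T ∧ σ.1 k ∈ S k σ).card : ℝ) := by
  unfold hit
  rw [Finset.sum_boole]
  congr 1
  symm
  refine Finset.card_bij (fun k _ => k.val) ?_ ?_ ?_
  · intro k hk
    simp only [Finset.mem_filter, Finset.mem_univ, true_and, Finset.mem_range] at hk ⊢
    exact ⟨hk.1, k.2, hk.2⟩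
  · intro k _ l _ h
    exact Fin.ext h
  · intro i hi
    simp only [Finset.mem_filter, Finset.mem_range] at hi
    obtain ⟨h1, h2, h3⟩ := hi
    exact ⟨⟨i, h2⟩, by simpa using ⟨h1, h3⟩, rfl⟩

lemma sum_hit_le_zero {n : ℕ} {S : ℕ → EdgeOrdering n → Finset (Sym2 (Fin n))}
    {σ : EdgeOrdering n} {T : ℕ} (h : ∀ k : Fin (n*(n-1)/2), k.val < T → σ.1 k ∉ S k σ) :
    ∑ i ∈ Finset.range T, hit S i σ ≤ 0 := by
  rw [sum_hit_eq_card, Finset.filter_eq_empty_iff.2]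
  · simp
  · rintro k - ⟨h1, h2⟩
    exact h k h1 h2

/-- The number of pairs at `x` among the first `i` edges. -/
def seenDegree {n : ℕ} (σ : EdgeOrdering n) (i : ℕ) (x : Fin n) : ℕ :=
  (Finset.univ.filter fun k : Fin (n*(n-1)/2) => k.val < i ∧ x ∈ σ.1 k).card

lemma seenDegree_mono {n : ℕ} (σ : EdgeOrdering n) (x : Fin n) {i j : ℕ} (h : i ≤ j) :
    seenDegree σ i x ≤ seenDegree σ j x := by
  refine Finset.card_le_card fun k hk => ?_
  simp only [Finset.mem_filter, Finset.mem_univ, true_and] at hk ⊢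
  exact ⟨by omega, hk.2⟩

lemma mul_le_two_mul_card_unseen {n : ℕ} (σ : EdgeOrdering n) (i : ℕ) (S : Finset (Sym2 (Fin n)))
    (X : Finset (Fin n)) (Y : Fin n → Finset (Fin n)) (m : ℝ)
    (hm : ∀ x ∈ X, m + seenDegree σ i x ≤ (Y x).card)
    (hS : ∀ x ∈ X, ∀ y ∈ Y x, x ≠ y ∧ s(x, y) ∈ S) :
    X.card * m ≤ 2 *
      ((Finset.univ.filter fun k : Fin (n*(n-1)/2) => i ≤ k.val ∧ σ.1 k ∈ S).card : ℝ) := by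
  set Q := Finset.univ.filter fun k : Fin (n*(n-1)/2) => i ≤ k.val ∧ σ.1 k ∈ S with hQ
  have hidx : ∀ x y : Fin n, x ≠ y → ∃ k, σ.1 k = s(x, y) := fun x y hxy =>
    σ.exists_eq (by simpa using hxy)
  set Y' : Fin n → Finset (Fin n) := fun x => (Y x).filter fun y => ∃ k ∈ Q, σ.1 k = s(x, y)
    with hY'
  have h1 : ∀ x ∈ X, m ≤ ((Y' x).card : ℝ) := by
    intro x hx
    have h2 : ((Y x).filter fun y => ¬ ∃ k ∈ Q, σ.1 k = s(x, y)).card ≤ seenDegree σ i x := by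
      have hch : ∀ y ∈ (Y x).filter fun y => ¬ ∃ k ∈ Q, σ.1 k = s(x, y),
          ∃ k ∈ Finset.univ.filter fun k : Fin (n*(n-1)/2) => k.val < i ∧ x ∈ σ.1 k,
            σ.1 k = s(x, y) := by
        intro y hy
        obtain ⟨hy1, hy2⟩ := Finset.mem_filter.1 hy
        obtain ⟨hxy, hSxy⟩ := hS x hx y hy1
        obtain ⟨k, hk⟩ := hidx x y hxy
        refine ⟨k, ?_, hk⟩
        simp only [Finset.mem_filter, Finset.mem_univ, true_and]
        refine ⟨?_, by rw [hk]; simp⟩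
        by_contra hlt
        exact hy2 ⟨k, by simp [hQ, not_lt.1 hlt, hk, hSxy], hk⟩
      refine Finset.card_le_card_of_forall_subsingleton (fun y k => σ.1 k = s(x, y)) hch ?_
      intro k _ y hy z hz
      have := hy.2.symm.trans hz.2
      exact Sym2.congr_right.1 this
    have h3 : (Y' x).card + ((Y x).filter fun y => ¬ ∃ k ∈ Q, σ.1 k = s(x, y)).card
        = (Y x).card := Finset.card_filter_add_card_filter_not _
    have h4 := hm x hx
    have h5 : ((Y x).card : ℝ) ≤ (Y' x).card + seenDegree σ i x := by
      exact_mod_cast (by omega : (Y x).card ≤ (Y' x).card + seenDegree σ i x)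
    linarith
  have h6 : (X.card : ℝ) * m ≤ ((X.sigma Y').card : ℝ) := by
    rw [Finset.card_sigma, Nat.cast_sum, ← nsmul_eq_mul]
    exact Finset.card_nsmul_le_sum _ _ _ h1
  have h7 : (X.sigma Y').card ≤ 2 * Q.card := by
    refine le_trans (Finset.card_le_mul_card_image_of_maps_to
      (f := fun a : (Σ _ : Fin n, Fin n) => s(a.1, a.2)) (t := Q.image σ.1) ?_ 2 ?_)
      (Nat.mul_le_mul_left 2 Finset.card_image_le)
    · intro a ha
      obtain ⟨k, hk, hka⟩ := (Finset.mem_filter.1 (Finset.mem_sigma.1 ha).2).2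
      exact Finset.mem_image.2 ⟨k, hk, hka⟩
    · intro e _
      induction e using Sym2.ind with
      | _ p q =>
        refine le_trans (Finset.card_le_card (t := {⟨p, q⟩, ⟨q, p⟩}) ?_) Finset.card_le_two
        rintro ⟨x, y⟩ ha
        have h9 := (Finset.mem_filter.1 ha).2
        rcases Sym2.eq_iff.1 h9 with ⟨h10, h11⟩ | ⟨h10, h11⟩ <;>
          (dsimp only at h10 h11; subst h10 h11; simp)
  have h8 : ((X.sigma Y').card : ℝ) ≤ 2 * Q.card := by exact_mod_cast h7
  linarith

lemma rate_nonneg {n : ℕ} (S : ℕ → EdgeOrdering n → Finset (Sym2 (Fin n))) {i : ℕ}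
    (hi : i ≤ n*(n-1)/2) (σ : EdgeOrdering n) : 0 ≤ rate S i σ := by
  unfold rate
  have : (i : ℝ) ≤ ((n*(n-1)/2 : ℕ) : ℝ) := by exact_mod_cast hi
  exact div_nonneg (Nat.cast_nonneg _) (by linarith)

lemma le_rate {n : ℕ} (hn : 0 < n) {S : ℕ → EdgeOrdering n → Finset (Sym2 (Fin n))}
    {σ : EdgeOrdering n} {i : ℕ} (hi : i < n*(n-1)/2)
    (X : Finset (Fin n)) (Y : Fin n → Finset (Fin n)) (m : ℝ)
    (hm : ∀ x ∈ X, m + seenDegree σ i x ≤ (Y x).card)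
    (hS : ∀ x ∈ X, ∀ y ∈ Y x, x ≠ y ∧ s(x, y) ∈ S i σ) :
    X.card * m / (n : ℝ)^2 ≤ rate S i σ := by
  have h := mul_le_two_mul_card_unseen σ i (S i σ) X Y m hm hS
  have h1 : (i : ℝ) < ((n*(n-1)/2 : ℕ) : ℝ) := by exact_mod_cast hi
  have h2 : ((n*(n-1)/2 : ℕ) : ℝ) ≤ (n : ℝ)^2 / 2 := by
    have h3 : n*(n-1)/2*2 ≤ n^2 := by
      refine (Nat.div_mul_le_self _ _).trans ?_
      rw [sq]
      exact Nat.mul_le_mul_left _ (Nat.sub_le _ _)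
    have h4 : ((n*(n-1)/2 : ℕ) : ℝ) * 2 ≤ (n : ℝ)^2 := by exact_mod_cast h3
    linarith
  have hn' : (0 : ℝ) < n := by exact_mod_cast hn
  have hi0 : (0 : ℝ) ≤ i := Nat.cast_nonneg i
  unfold rate
  set c := ((Finset.univ.filter fun k : Fin (n*(n-1)/2) => i ≤ k.val ∧ σ.1 k ∈ S i σ).card : ℝ)
  have hc : 0 ≤ c := Nat.cast_nonneg _
  rw [div_le_div_iff₀ (by positivity) (by linarith)]
  nlinarith

lemma rate_le {n : ℕ} {S : ℕ → EdgeOrdering n → Finset (Sym2 (Fin n))}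
    {σ : EdgeOrdering n} {i : ℕ} (hn : 0 < n)
    (hi : (n : ℝ)^2 / 4 ≤ ((n*(n-1)/2 : ℕ) : ℝ) - i) (X : Finset (Fin n))
    (hS : ∀ e ∈ S i σ, ∃ v ∈ X, v ∈ e) : rate S i σ ≤ 4 * X.card / n := by
  have hn' : (0 : ℝ) < n := by exact_mod_cast hn
  have h1 : (Finset.univ.filter fun k : Fin (n*(n-1)/2) => i ≤ k.val ∧ σ.1 k ∈ S i σ).card
      ≤ X.card * n := by
    calc _ ≤ (S i σ).card := Finset.card_le_card_of_injOn σ.1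
          (fun k hk => (Finset.mem_filter.1 hk).2.2) σ.2.1.injOn
      _ ≤ ((X ×ˢ (Finset.univ : Finset (Fin n))).image fun a => s(a.1, a.2)).card := by
          refine Finset.card_le_card fun e he => ?_
          obtain ⟨v, hv, hve⟩ := hS e he
          obtain ⟨w, rfl⟩ := Sym2.mem_iff_exists.1 hve
          exact Finset.mem_image.2 ⟨(v, w), by simp [hv], rfl⟩
      _ ≤ _ := Finset.card_image_le.trans (by simp)
  have h2 : ((Finset.univ.filter fun k : Fin (n*(n-1)/2) => i ≤ k.val ∧ σ.1 k ∈ S i σ).card : ℝ)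
      ≤ X.card * n := by exact_mod_cast h1
  have h0 : (0 : ℝ) < (n : ℝ)^2 / 4 := by positivity
  unfold rate
  rw [div_le_div_iff₀ (by linarith) hn']
  have hX : (0 : ℝ) ≤ X.card := Nat.cast_nonneg _
  nlinarith [mul_le_mul_of_nonneg_left hi hX]

/-! ### Typical orderings -/

/-- All pairs at the vertex `v`. -/
def incidentPairs {n : ℕ} (v : Fin n) : ℕ → EdgeOrdering n → Finset (Sym2 (Fin n)) :=
  fun _ _ => Finset.univ.filter fun e => v ∈ e

/-- The pairs inside `I` with an endpoint in some minimum cover of the current graph. -/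
def insidePairs {n : ℕ} (I : Finset (Fin n)) : ℕ → EdgeOrdering n → Finset (Sym2 (Fin n)) :=
  fun i σ => Finset.univ.filter fun e =>
    (∀ v ∈ e, v ∈ I) ∧ ∃ v ∈ e, v ∈ canCover (KonigProc σ i)

/-- The pairs touching a vertex of `C` that is in no minimum cover of the current graph. -/
def uncoveredPairs {n : ℕ} (C : Finset (Fin n)) : ℕ → EdgeOrdering n → Finset (Sym2 (Fin n)) :=
  fun i σ => Finset.univ.filter fun e => ∃ v ∈ C \ canCover (KonigProc σ i), v ∈ e

/-- The pairs joining `D` to a vertex outside `A` in some minimum cover of the current graph. -/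
def escapingPairs {n : ℕ} (D A : Finset (Fin n)) : ℕ → EdgeOrdering n → Finset (Sym2 (Fin n)) :=
  fun i σ => Finset.univ.filter fun e =>
    ∃ x ∈ D, ∃ y ∈ canCover (KonigProc σ i), y ∉ A ∧ e = s(x, y)

/-- The pairs whose addition increases the matching number of the current graph. -/
def augmentingPairs {n : ℕ} : ℕ → EdgeOrdering n → Finset (Sym2 (Fin n)) :=
  fun i σ => Finset.univ.filter fun e =>
    matchNum (KonigProc σ i) < matchNum (KonigProc σ i ⊔ SimpleGraph.fromEdgeSet {e})

lemma incidentPairs_isAdapted {n : ℕ} (v : Fin n) : IsAdapted (incidentPairs v) :=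
  fun _ _ _ _ _ _ => rfl

lemma insidePairs_isAdapted {n : ℕ} (I : Finset (Fin n)) : IsAdapted (insidePairs I) :=
  konigProc_isAdapted.comp fun G => Finset.univ.filter fun e =>
    (∀ v ∈ e, v ∈ I) ∧ ∃ v ∈ e, v ∈ canCover G

lemma uncoveredPairs_isAdapted {n : ℕ} (C : Finset (Fin n)) : IsAdapted (uncoveredPairs C) :=
  konigProc_isAdapted.comp fun G => Finset.univ.filter fun e => ∃ v ∈ C \ canCover G, v ∈ e

lemma escapingPairs_isAdapted {n : ℕ} (D A : Finset (Fin n)) : IsAdapted (escapingPairs D A) :=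
  konigProc_isAdapted.comp fun G => Finset.univ.filter fun e =>
    ∃ x ∈ D, ∃ y ∈ canCover G, y ∉ A ∧ e = s(x, y)

lemma augmentingPairs_isAdapted {n : ℕ} : IsAdapted (augmentingPairs (n := n)) :=
  konigProc_isAdapted.comp fun G => Finset.univ.filter fun e =>
    matchNum G < matchNum (G ⊔ SimpleGraph.fromEdgeSet {e})

/-- The rate `exp (-(i - 1024 n) / (64 n))` at which obstructions to matching disappear. -/
def decay (n i : ℕ) : ℝ := Real.exp (-(((i : ℝ) - 1024 * n) / (64 * n)))

/-- The concentration properties of an ordering used in the deterministic argument. -/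
structure IsTypical {n : ℕ} (T : ℕ) (K : ℝ) (σ : EdgeOrdering n) : Prop where
  degree : ∀ v, ∑ i ∈ Finset.range T, hit (incidentPairs v) i σ < (n : ℝ) / 32
  inside : ∀ I, ∑ i ∈ Finset.range T, hit (insidePairs I) i σ ≤ 0 →
    ∑ i ∈ Finset.range T, rate (insidePairs I) i σ < 4 * n
  uncovered : ∀ C, ∑ i ∈ Finset.range T, rate (uncoveredPairs C) i σ ≤ 4 * K * n →
    ∑ i ∈ Finset.range T, hit (uncoveredPairs C) i σ < (8 * K + 2) * n
  escaping : ∀ i, 1024 * n ≤ i → i < T → ∀ D A : Finset (Fin n), D.card = A.card →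
    (n.choose D.card : ℝ) * decay n i ^ D.card ≤ 1 / (n : ℝ)^2 →
    ∑ j ∈ Finset.range i, hit (escapingPairs D A) j σ ≤ 0 →
    ∑ j ∈ Finset.range i, rate (escapingPairs D A) j σ < D.card * ((i : ℝ) - 1024 * n) / (16 * n)
  augmenting : ∑ i ∈ Finset.range T, hit augmentingPairs i σ ≤ (n : ℝ) / 2 →
    ∑ i ∈ Finset.range T, rate augmentingPairs i σ < 2 * n

lemma IsTypical.seenDegree_le {n T : ℕ} {K : ℝ} {σ : EdgeOrdering n} (h : IsTypical T K σ)
    {i : ℕ} (hi : i ≤ T) (x : Fin n) : (seenDegree σ i x : ℝ) ≤ (n : ℝ) / 32 := by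
  have h1 := h.degree x
  rw [sum_hit_eq_card] at h1
  have h2 : (seenDegree σ i x : ℝ) ≤ seenDegree σ T x := by
    exact_mod_cast seenDegree_mono σ x hi
  refine h2.trans (le_of_eq_of_le ?_ h1.le)
  unfold seenDegree
  simp [incidentPairs]

lemma sum_hit_augmentingPairs_le {n : ℕ} (σ : EdgeOrdering n) (T : ℕ) :
    ∑ i ∈ Finset.range T, hit augmentingPairs i σ ≤ matchNum (KonigProc σ T) := by
  induction T with
  | zero => simp
  | succ T ih =>
    rw [Finset.sum_range_succ]
    have hmono : (matchNum (KonigProc σ T) : ℝ) ≤ matchNum (KonigProc σ (T+1)) := by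
      exact_mod_cast matchNum_mono (konigProc_mono σ (Nat.le_succ T))
    unfold hit
    split_ifs with h
    · obtain ⟨hT, hmem⟩ := h
      have hlt := (Finset.mem_filter.1 hmem).2
      rw [← konigProc_succ_of_isKonig σ hT
        ((konigProc_isKonig σ T).sup_of_matchNum_lt hlt)] at hlt
      have : (matchNum (KonigProc σ T) : ℝ) + 1 ≤ matchNum (KonigProc σ (T+1)) := by
        exact_mod_cast hlt
      unfold hit at ih
      linarith
    · unfold hit at ih
      linarith

lemma IsTypical.sum_rate_augmenting_lt {n T : ℕ} {K : ℝ} {σ : EdgeOrdering n}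
    (h : IsTypical T K σ) : ∑ i ∈ Finset.range T, rate augmentingPairs i σ < 2 * n := by
  refine h.augmenting ((sum_hit_augmentingPairs_le σ T).trans ?_)
  have := (konigProc_isKonig σ T).two_mul_matchNum_le
  have h2 : (2 : ℝ) * matchNum (KonigProc σ T) ≤ n := by exact_mod_cast this
  linarith

/-- The times at which the matching number increases with probability bounded below. -/
def augmentingTimes {n : ℕ} (T : ℕ) (σ : EdgeOrdering n) : Finset ℕ :=
  (Finset.range T).filter fun i => 1 / 512 ≤ rate augmentingPairs i σ

lemma IsTypical.card_augmentingTimes_le {n T : ℕ} {K : ℝ} {σ : EdgeOrdering n}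
    (h : IsTypical T K σ) (hTN : T ≤ n*(n-1)/2) : (augmentingTimes T σ).card ≤ 1024 * n := by
  have h1 := h.sum_rate_augmenting_lt
  have h2 : ((augmentingTimes T σ).card : ℝ) * (1 / 512)
      ≤ ∑ i ∈ Finset.range T, rate augmentingPairs i σ := by
    calc ((augmentingTimes T σ).card : ℝ) * (1 / 512)
        ≤ ∑ i ∈ augmentingTimes T σ, rate augmentingPairs i σ := by
          rw [← nsmul_eq_mul]
          exact Finset.card_nsmul_le_sum _ _ _ fun i hi => (Finset.mem_filter.1 hi).2
      _ ≤ _ := Finset.sum_le_sum_of_subset_of_nonneg (Finset.filter_subset _ _) fun i hi _ =>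
          rate_nonneg _ ((Finset.mem_range.1 hi).le.trans hTN) σ
  have h3 : ((augmentingTimes T σ).card : ℝ) ≤ 1024 * n := by linarith
  exact_mod_cast h3

lemma IsTypical.mem_augmentingTimes {n T : ℕ} {K : ℝ} {σ : EdgeOrdering n}
    (h : IsTypical T K σ) (hn : 0 < n) (hTN : T ≤ n*(n-1)/2) {i : ℕ} (hi : i < T)
    (hd : 2 * matchNum (KonigProc σ i) + 2 ≤ n)
    (hexp : ∀ D A : Finset (Fin n), D.card = A.card →
      n - 2 * matchNum (KonigProc σ i) - 1 ≤ D.card → D.card ≤ n / 16 →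
      ¬ ∀ x ∈ D, ∀ y, (KonigProc σ i).Adj x y → y ∈ A) :
    i ∈ augmentingTimes T σ := by
  obtain ⟨X, Y, hX, hY⟩ := (konigProc_isKonig σ i).exists_many_augmenting (n / 16) hd hexp
  refine Finset.mem_filter.2 ⟨Finset.mem_range.2 hi, ?_⟩
  have hn' : (0 : ℝ) < n := by exact_mod_cast hn
  have hL : ∀ m : ℕ, n / 16 < m → (n : ℝ) / 16 ≤ m := by
    intro m hm
    have : n ≤ 16 * m := by omega
    have : (n : ℝ) ≤ 16 * m := by exact_mod_cast this
    linarith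
  have h1 := le_rate (S := augmentingPairs) (σ := σ) (i := i) hn (by omega) X Y ((n : ℝ) / 32) ?_ ?_
  · refine le_trans ?_ h1
    have := hL _ hX
    rw [le_div_iff₀ (by positivity)]
    nlinarith
  · intro x hx
    have h2 := h.seenDegree_le hi.le x
    have h3 := hL _ (hY x hx).1
    linarith
  · intro x hx y hy
    obtain ⟨h2, h3⟩ := (hY x hx).2 y hy
    exact ⟨h2, Finset.mem_filter.2 ⟨Finset.mem_univ _, h3⟩⟩

lemma IsTypical.le_four_mul_matchNum {n T : ℕ} {K : ℝ} {σ : EdgeOrdering n}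
    (h : IsTypical T K σ) (hn : 8 ≤ n) (hTN : T ≤ n*(n-1)/2) {j : ℕ} (hj : 1024 * n ≤ j)
    (hjT : j < T) : n ≤ 4 * matchNum (KonigProc σ j) := by
  by_contra hlt
  have hsub : Finset.range (1024 * n + 1) ⊆ augmentingTimes T σ := by
    intro i hi
    have hi' := Finset.mem_range.1 hi
    have hmono := matchNum_mono (konigProc_mono σ (by omega : i ≤ j))
    refine h.mem_augmentingTimes (by omega) hTN (by omega) (by omega) ?_
    intro D A _ h1 h2
    omega
  have h1 := Finset.card_le_card hsub
  rw [Finset.card_range] at h1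
  have := h.card_augmentingTimes_le hTN
  omega

lemma IsTypical.not_closed {n T : ℕ} {K : ℝ} {σ : EdgeOrdering n}
    (h : IsTypical T K σ) (hn : 32 ≤ n) (hTN : T ≤ n*(n-1)/2) {i : ℕ} (hi : 1024 * n ≤ i)
    (hiT : i < T) {D A : Finset (Fin n)} (hDA : D.card = A.card) (hD : D.card ≤ n / 16)
    (hadm : (n.choose D.card : ℝ) * decay n i ^ D.card ≤ 1 / (n : ℝ)^2) :
    ¬ ∀ x ∈ D, ∀ y, (KonigProc σ i).Adj x y → y ∈ A := by
  intro hcl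
  have hn' : (32 : ℝ) ≤ n := by exact_mod_cast hn
  have hhit : ∑ j ∈ Finset.range i, hit (escapingPairs D A) j σ ≤ 0 := by
    refine sum_hit_le_zero fun k hk hmem => ?_
    obtain ⟨x, hx, y, hy, hyA, he⟩ := (Finset.mem_filter.1 hmem).2
    have := konigProc_accepts σ k hy (by rw [he]; simp) hk
    rw [he, SimpleGraph.mem_edgeSet] at this
    exact hyA (hcl x hx y this)
  have h1 := h.escaping i hi hiT D A hDA hadm hhit
  have hrate : ∀ j ∈ Finset.Ico (1024 * n) i,
      (D.card : ℝ) / (16 * n) ≤ rate (escapingPairs D A) j σ := by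
    intro j hj
    obtain ⟨hj1, hj2⟩ := Finset.mem_Ico.1 hj
    have h2 := le_rate (S := escapingPairs D A) (σ := σ) (i := j) (by omega) (by omega) D
      (fun x => (canCover (KonigProc σ j) \ A).erase x) ((n : ℝ) / 16) ?_ ?_
    · refine le_trans (le_of_eq ?_) h2
      field_simp
    · intro x _
      have h3 := h.seenDegree_le (by omega : j ≤ T) x
      have h4 := h.le_four_mul_matchNum (by omega) hTN hj1 (by omega)
      have h5 := matchNum_le_card_canCover (KonigProc σ j)
      have h6 := Finset.le_card_sdiff A (canCover (KonigProc σ j))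
      have h7 : (canCover (KonigProc σ j) \ A).card - 1
          ≤ ((canCover (KonigProc σ j) \ A).erase x).card := Finset.pred_card_le_card_erase
      have h8 : 3 * n ≤ 16 * (((canCover (KonigProc σ j) \ A).erase x).card + 1) := by omega
      have h9 : (3 : ℝ) * n ≤ 16 * (((canCover (KonigProc σ j) \ A).erase x).card + 1) := by
        exact_mod_cast h8
      linarith
    · intro x hx y hy
      obtain ⟨hyx, hy'⟩ := Finset.mem_erase.1 hy
      obtain ⟨hy1, hy2⟩ := Finset.mem_sdiff.1 hy'
      exact ⟨hyx.symm, Finset.mem_filter.2 ⟨Finset.mem_univ _, x, hx, y, hy1, hy2, rfl⟩⟩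
  have h2 : ((i - 1024 * n : ℕ) : ℝ) * ((D.card : ℝ) / (16 * n))
      ≤ ∑ j ∈ Finset.range i, rate (escapingPairs D A) j σ := by
    calc _ ≤ ∑ j ∈ Finset.Ico (1024 * n) i, rate (escapingPairs D A) j σ := by
          rw [← nsmul_eq_mul, ← Nat.card_Ico]
          exact Finset.card_nsmul_le_sum _ _ _ hrate
      _ ≤ _ := by
          refine Finset.sum_le_sum_of_subset_of_nonneg ?_ fun j hj _ =>
            rate_nonneg _ (by have := Finset.mem_range.1 hj; omega) σ
          intro j hj
          exact Finset.mem_range.2 (Finset.mem_Ico.1 hj).2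
  rw [Nat.cast_sub hi] at h2
  push_cast at h2
  have h3 : ((i : ℝ) - 1024 * n) * ((D.card : ℝ) / (16 * n))
      = D.card * ((i : ℝ) - 1024 * n) / (16 * n) := by ring
  linarith

/-! ### The total deficiency -/

lemma choose_mul_pow_le_exp (n k : ℕ) {x : ℝ} (hx : 0 ≤ x) :
    (n.choose k : ℝ) * x ^ k ≤ Real.exp (n * x) := by
  rcases lt_or_ge n k with h | h
  · rw [Nat.choose_eq_zero_of_lt h]
    simpa using (Real.exp_pos _).le
  · have h1 : x ^ k * (n.choose k : ℝ) ≤ (x + 1) ^ n := by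
      rw [add_pow]
      have := Finset.single_le_sum (f := fun m => x ^ m * 1 ^ (n - m) * (n.choose m : ℝ))
        (fun m _ => by positivity) (Finset.mem_range.2 (by omega : k < n + 1))
      simpa using this
    rw [mul_comm, Real.exp_nat_mul]
    exact h1.trans (pow_le_pow_left₀ (by positivity) (Real.add_one_le_exp x) n)

/-- `T` and `T₁` are a final time and a time of perfect matchability suited to order `n`. -/
structure IsSuitable (n T T₁ : ℕ) : Prop where
  large : 1000 ≤ n
  le_total : T ≤ n*(n-1)/2
  mul_le_sq : 1024 * T ≤ n^2
  remaining : (n : ℝ)^2 / 4 ≤ ((n*(n-1)/2 : ℕ) : ℝ) - T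
  exp_sqrt_le : Real.exp (-√n) ≤ 1 / (n : ℝ)^2
  le_early : 1024 * n ≤ T₁
  decay_le : ∀ i, T₁ ≤ i → decay n i ≤ 1 / (n : ℝ)^3
  early_mul_le : (T₁ : ℝ) * (1 + √n) ≤ (n : ℝ)^2
  early_add_lt : T₁ + 1024 * n < T

lemma decay_nonneg (n i : ℕ) : 0 ≤ decay n i := (Real.exp_pos _).le

lemma choose_mul_decay_pow_le_of_sqrt_le {n i k : ℕ} (hn : 0 < n)
    (hexp : Real.exp (-√n) ≤ 1 / (n : ℝ)^2)
    (hk : √n ≤ (k : ℝ)) (hd : Real.exp 2 * n * decay n i ≤ k) :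
    (n.choose k : ℝ) * decay n i ^ k ≤ 1 / (n : ℝ)^2 := by
  have hn' : (0 : ℝ) < n := by exact_mod_cast hn
  have h1 : decay n i ≤ (k : ℝ) / n * Real.exp (-2) := by
    rw [Real.exp_neg, ← div_eq_mul_inv, le_div_iff₀ (Real.exp_pos 2), le_div_iff₀ hn']
    linarith
  have h2 := choose_mul_pow_le_exp n k (x := (k : ℝ) / n) (by positivity)
  calc (n.choose k : ℝ) * decay n i ^ k
      ≤ (n.choose k : ℝ) * ((k : ℝ) / n * Real.exp (-2)) ^ k := by
        have := decay_nonneg n i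
        gcongr
    _ = (n.choose k : ℝ) * ((k : ℝ) / n) ^ k * Real.exp (-2) ^ k := by rw [mul_pow, mul_assoc]
    _ ≤ Real.exp (n * ((k : ℝ) / n)) * Real.exp (-2) ^ k := by gcongr
    _ = Real.exp (-k) := by
        rw [← Real.exp_nat_mul, ← Real.exp_add]
        congr 1
        field_simp
        ring
    _ ≤ Real.exp (-√n) := Real.exp_le_exp.2 (by linarith)
    _ ≤ _ := hexp

lemma choose_mul_decay_pow_le_of_decay_le {n i k : ℕ} (hn : 0 < n) (hk : 1 ≤ k)
    (hd : decay n i ≤ 1 / (n : ℝ)^3) :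
    (n.choose k : ℝ) * decay n i ^ k ≤ 1 / (n : ℝ)^2 := by
  have hn' : (1 : ℝ) ≤ n := by exact_mod_cast hn
  have h0 := decay_nonneg n i
  have h1 : (n : ℝ) * decay n i ≤ 1 / (n : ℝ)^2 := by
    calc (n : ℝ) * decay n i ≤ n * (1 / (n : ℝ)^3) := by gcongr
      _ = _ := by field_simp
  have h2 : 1 / (n : ℝ)^2 ≤ 1 := by
    rw [div_le_one (by positivity)]
    nlinarith
  calc (n.choose k : ℝ) * decay n i ^ k ≤ (n : ℝ) ^ k * decay n i ^ k := by
        gcongr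
        exact_mod_cast Nat.choose_le_pow n k
    _ = ((n : ℝ) * decay n i) ^ k := (mul_pow _ _ _).symm
    _ ≤ (n : ℝ) * decay n i :=
        pow_le_of_le_one (by positivity) (h1.trans h2) (by omega)
    _ ≤ _ := h1

lemma IsTypical.eq_two_mul_matchNum {n T T₁ : ℕ} {K : ℝ} {σ : EdgeOrdering n}
    (h : IsTypical T K σ) (hs : IsSuitable n T T₁) (hev : Even n) {i : ℕ} (hi : T₁ ≤ i)
    (hiT : i < T) (haug : i ∉ augmentingTimes T σ) : n = 2 * matchNum (KonigProc σ i) := by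
  have hlarge := hs.large
  have h1 := (konigProc_isKonig σ i).two_mul_matchNum_le
  by_contra hne
  obtain ⟨m, hm⟩ := hev
  refine haug (h.mem_augmentingTimes (by omega) hs.le_total hiT (by omega) ?_)
  intro D A hDA hD1 hD2
  exact h.not_closed (by omega) hs.le_total (hs.le_early.trans hi) hiT hDA hD2
    (choose_mul_decay_pow_le_of_decay_le (by omega) (by omega) (hs.decay_le i hi))

lemma IsTypical.deficiency_le {n T T₁ : ℕ} {K : ℝ} {σ : EdgeOrdering n}
    (h : IsTypical T K σ) (hs : IsSuitable n T T₁) {i : ℕ}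
    (hiT : i < T) (haug : i ∉ augmentingTimes T σ) :
    (n : ℝ) - 2 * matchNum (KonigProc σ i) ≤ 1 + √n + Real.exp 2 * n * decay n i := by
  have hlarge := hs.large
  have hn' : (0 : ℝ) < n := by exact_mod_cast (by omega : 0 < n)
  have hsq := Real.sqrt_nonneg (n : ℝ)
  have hpos : 0 ≤ Real.exp 2 * n * decay n i := by
    have := decay_nonneg n i
    positivity
  rcases lt_or_ge i (1024 * n) with hi | hi
  · have h1 : (1 : ℝ) ≤ decay n i := by
      refine Real.one_le_exp ?_
      have : (i : ℝ) < 1024 * n := by exact_mod_cast hi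
      rw [neg_nonneg]
      exact div_nonpos_of_nonpos_of_nonneg (by linarith) (by positivity)
    have h2 : (1 : ℝ) ≤ Real.exp 2 := Real.one_le_exp (by norm_num)
    have h3 : (n : ℝ) ≤ Real.exp 2 * n * decay n i := by
      calc (n : ℝ) = 1 * n * 1 := by ring
        _ ≤ Real.exp 2 * n * decay n i := by gcongr
    have : (0 : ℝ) ≤ matchNum (KonigProc σ i) := Nat.cast_nonneg _
    linarith
  · by_contra hlt
    rw [not_le] at hlt
    have h1 : 2 * matchNum (KonigProc σ i) + 1 < n := by
      have : (2 : ℝ) * matchNum (KonigProc σ i) + 1 < n := by linarith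
      exact_mod_cast this
    refine haug (h.mem_augmentingTimes (by omega) hs.le_total hiT (by omega) ?_)
    intro D A hDA hD1 hD2
    have h2 : (n : ℝ) ≤ D.card + 2 * matchNum (KonigProc σ i) + 1 := by
      exact_mod_cast (by omega : n ≤ D.card + 2 * matchNum (KonigProc σ i) + 1)
    exact h.not_closed (by omega) hs.le_total hi hiT hDA hD2
      (choose_mul_decay_pow_le_of_sqrt_le (by omega) hs.exp_sqrt_le (by linarith) (by linarith))

lemma sum_decay_le {n : ℕ} (hn : 0 < n) (T : ℕ) :
    ∑ i ∈ Finset.range T, decay n i ≤ Real.exp 16 * (128 * n) := by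
  have hn' : (1 : ℝ) ≤ n := by exact_mod_cast hn
  set x : ℝ := 1 / (64 * n) with hx
  have hx0 : 0 < x := by positivity
  have hx1 : x ≤ 1 := by
    rw [hx, div_le_one (by positivity)]
    linarith
  have hdecay : ∀ i, decay n i = Real.exp 16 * Real.exp (-x) ^ i := by
    intro i
    rw [← Real.exp_nat_mul, ← Real.exp_add]
    unfold decay
    congr 1
    rw [hx]
    field_simp
    ring
  have h1 : x / 2 ≤ 1 - Real.exp (-x) := by
    have h2 : Real.exp (-x) * Real.exp x = 1 := by rw [← Real.exp_add]; simp
    have h3 := Real.add_one_le_exp x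
    have h4 := Real.exp_pos (-x)
    have h5 : Real.exp (-x) * (x + 1) ≤ 1 := by nlinarith
    nlinarith
  have h2 : ∑ i ∈ Finset.range T, Real.exp (-x) ^ i ≤ 128 * n := by
    have h3 := mul_neg_geom_sum (Real.exp (-x)) T
    have h4 : (1 - Real.exp (-x)) * ∑ i ∈ Finset.range T, Real.exp (-x) ^ i ≤ 1 := by
      rw [h3]
      have : 0 < Real.exp (-x) ^ T := by positivity
      linarith
    have h5 : 0 ≤ ∑ i ∈ Finset.range T, Real.exp (-x) ^ i :=
      Finset.sum_nonneg fun i _ => by positivity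
    have h6 : x / 2 * ∑ i ∈ Finset.range T, Real.exp (-x) ^ i ≤ 1 := by nlinarith
    have h7 : x / 2 * (128 * n) = 1 := by rw [hx]; field_simp; norm_num
    by_contra hlt
    rw [not_le] at hlt
    nlinarith
  calc ∑ i ∈ Finset.range T, decay n i
      = Real.exp 16 * ∑ i ∈ Finset.range T, Real.exp (-x) ^ i := by
        rw [Finset.mul_sum]
        exact Finset.sum_congr rfl fun i _ => hdecay i
    _ ≤ _ := by gcongr

/-- The constant in the bound for the total deficiency. -/
def deficiencyConst : ℝ := 1025 + 128 * (Real.exp 2 * Real.exp 16)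

lemma deficiencyConst_pos : 0 < deficiencyConst := by
  unfold deficiencyConst
  positivity

lemma IsTypical.sum_deficiency_le {n T T₁ : ℕ} {K : ℝ} {σ : EdgeOrdering n}
    (h : IsTypical T K σ) (hs : IsSuitable n T T₁) (hev : Even n) :
    ∑ i ∈ Finset.range T, ((n : ℝ) - 2 * matchNum (KonigProc σ i))
      ≤ deficiencyConst * (n : ℝ)^2 := by
  have hlarge := hs.large
  have hsq := Real.sqrt_nonneg (n : ℝ)
  have hn0 : (0 : ℝ) ≤ n := Nat.cast_nonneg n
  have hterm : ∀ i ∈ Finset.range T, (n : ℝ) - 2 * matchNum (KonigProc σ i)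
      ≤ ((if i ∈ augmentingTimes T σ then (n : ℝ) else 0) + if i < T₁ then 1 + √n else 0)
        + Real.exp 2 * n * decay n i := by
    intro i hi
    have hiT := Finset.mem_range.1 hi
    have hpos : 0 ≤ Real.exp 2 * n * decay n i := by
      have := decay_nonneg n i
      positivity
    have hm : (0 : ℝ) ≤ matchNum (KonigProc σ i) := Nat.cast_nonneg _
    by_cases haug : i ∈ augmentingTimes T σ
    · rw [if_pos haug]
      split_ifs <;> linarith
    · rw [if_neg haug]
      split_ifs with hT₁
      · have := h.deficiency_le hs hiT haug
        linarith
      · have h1 := h.eq_two_mul_matchNum hs hev (not_lt.1 hT₁) hiT haug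
        have h2 : (n : ℝ) = 2 * matchNum (KonigProc σ i) := by exact_mod_cast h1
        linarith
  refine (Finset.sum_le_sum hterm).trans ?_
  rw [Finset.sum_add_distrib, Finset.sum_add_distrib, ← Finset.mul_sum, ← Finset.sum_filter,
    ← Finset.sum_filter, Finset.sum_const, Finset.sum_const, nsmul_eq_mul, nsmul_eq_mul]
  have h1 : ((Finset.range T).filter fun i => i ∈ augmentingTimes T σ).card ≤ 1024 * n := by
    refine le_trans (Finset.card_le_card fun i hi => ?_) (h.card_augmentingTimes_le hs.le_total)
    exact (Finset.mem_filter.1 hi).2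
  have h2 : ((Finset.range T).filter fun i => i < T₁).card ≤ T₁ := by
    refine le_trans (Finset.card_le_card (t := Finset.range T₁) fun i hi => ?_)
      (Finset.card_range T₁).le
    exact Finset.mem_range.2 (Finset.mem_filter.1 hi).2
  have h1' : (((Finset.range T).filter fun i => i ∈ augmentingTimes T σ).card : ℝ)
      ≤ 1024 * n := by exact_mod_cast h1
  have h2' : (((Finset.range T).filter fun i => i < T₁).card : ℝ) ≤ T₁ := by exact_mod_cast h2
  calc _ ≤ 1024 * (n : ℝ) * n + T₁ * (1 + √n)
        + Real.exp 2 * n * (Real.exp 16 * (128 * n)) := by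
        gcongr
        exact sum_decay_le (by omega) T
    _ ≤ 1024 * (n : ℝ) * n + (n : ℝ)^2 + Real.exp 2 * n * (Real.exp 16 * (128 * n)) := by
        have := hs.early_mul_le
        gcongr
    _ = _ := by unfold deficiencyConst; ring

lemma IsTypical.exists_perfect_time {n T T₁ : ℕ} {K : ℝ} {σ : EdgeOrdering n}
    (h : IsTypical T K σ) (hs : IsSuitable n T T₁) (hev : Even n) :
    ∃ i < T, n = 2 * matchNum (KonigProc σ i) := by
  have h1 : ∃ i ∈ Finset.Ico T₁ T, i ∉ augmentingTimes T σ := by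
    by_contra! hall
    have h2 := Finset.card_le_card (fun i hi => hall i hi : Finset.Ico T₁ T ⊆ _)
    rw [Nat.card_Ico] at h2
    have := h.card_augmentingTimes_le hs.le_total
    have := hs.early_add_lt
    omega
  obtain ⟨i, hi, haug⟩ := h1
  obtain ⟨h3, h4⟩ := Finset.mem_Ico.1 hi
  exact ⟨i, h4, h.eq_two_mul_matchNum hs hev h3 h4 haug⟩

/-! ### Missing pairs in typical orderings -/

lemma IsTypical.sum_card_canCover_sdiff_le {n T T₁ : ℕ} {K : ℝ} {σ : EdgeOrdering n}
    (h : IsTypical T K σ) (hs : IsSuitable n T T₁) {C : Finset (Fin n)}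
    (hC : IsVertexCover (KonigProc σ (n*(n-1)/2)) C) (hCn : 2 * C.card ≤ n) :
    ∑ i ∈ Finset.range T, ((canCover (KonigProc σ i) \ C).card : ℝ) ≤ 16 * (n : ℝ)^2 := by
  have hlarge := hs.large
  have hn' : (1000 : ℝ) ≤ n := by exact_mod_cast hlarge
  have hTN := hs.le_total
  have hhit : ∑ i ∈ Finset.range T, hit (insidePairs Cᶜ) i σ ≤ 0 := by
    refine sum_hit_le_zero fun k hk hmem => ?_
    obtain ⟨hin, v, hve, hv⟩ := (Finset.mem_filter.1 hmem).2
    obtain ⟨w, hw, hwe⟩ := hC _ (konigProc_accepts σ k hv hve k.2)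
    exact Finset.mem_compl.1 (hin w hwe) hw
  have h1 := h.inside Cᶜ hhit
  have hrate : ∀ i ∈ Finset.range T,
      ((canCover (KonigProc σ i) \ C).card : ℝ) / (4 * n) ≤ rate (insidePairs Cᶜ) i σ := by
    intro i hi
    have hiT := Finset.mem_range.1 hi
    have h2 := le_rate (S := insidePairs Cᶜ) (σ := σ) (i := i) (by omega) (by omega)
      (canCover (KonigProc σ i) \ C) (fun x => Cᶜ.erase x) ((n : ℝ) / 4) ?_ ?_
    · refine le_trans (le_of_eq ?_) h2
      field_simp
    · intro x _
      have h3 := h.seenDegree_le hiT.le x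
      have h4 : Cᶜ.card - 1 ≤ (Cᶜ.erase x).card := Finset.pred_card_le_card_erase
      rw [Finset.card_compl, Fintype.card_fin] at h4
      have h5 : (n : ℝ) ≤ 2 * ((Cᶜ.erase x).card + 1) := by
        exact_mod_cast (by omega : n ≤ 2 * ((Cᶜ.erase x).card + 1))
      linarith
    · intro x hx y hy
      obtain ⟨hyx, hyC⟩ := Finset.mem_erase.1 hy
      obtain ⟨hxc, hxC⟩ := Finset.mem_sdiff.1 hx
      refine ⟨hyx.symm, Finset.mem_filter.2 ⟨Finset.mem_univ _, ?_, x, by simp, hxc⟩⟩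
      intro v hv
      rcases Sym2.mem_iff.1 hv with rfl | rfl
      · exact Finset.mem_compl.2 hxC
      · exact hyC
  have h2 := (Finset.sum_le_sum hrate).trans h1.le
  rw [← Finset.sum_div, div_le_iff₀ (by positivity)] at h2
  linarith

lemma IsTypical.sum_rate_uncoveredPairs_le {n T T₁ : ℕ} {K : ℝ} {σ : EdgeOrdering n}
    (h : IsTypical T K σ) (hs : IsSuitable n T T₁) (hev : Even n) {C : Finset (Fin n)}
    (hC : IsVertexCover (KonigProc σ (n*(n-1)/2)) C) (hCn : 2 * C.card ≤ n) :
    ∑ i ∈ Finset.range T, rate (uncoveredPairs C) i σ ≤ 4 * (deficiencyConst + 16) * n := by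
  have hlarge := hs.large
  have hn' : (1000 : ℝ) ≤ n := by exact_mod_cast hlarge
  have h1 := h.sum_card_canCover_sdiff_le hs hC hCn
  have h2 := h.sum_deficiency_le hs hev
  have hcard : ∀ i ∈ Finset.range T, ((C \ canCover (KonigProc σ i)).card : ℝ)
      ≤ ((n : ℝ) - 2 * matchNum (KonigProc σ i)) + (canCover (KonigProc σ i) \ C).card := by
    intro i _
    have h3 := Finset.card_sdiff_add_card_inter C (canCover (KonigProc σ i))
    have h4 := Finset.card_sdiff_add_card_inter (canCover (KonigProc σ i)) C
    rw [Finset.inter_comm] at h4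
    have h5 := matchNum_le_card_canCover (KonigProc σ i)
    have h6 := (konigProc_isKonig σ i).two_mul_matchNum_le
    have h7 : ((C \ canCover (KonigProc σ i)).card : ℝ) + 2 * matchNum (KonigProc σ i)
        ≤ n + (canCover (KonigProc σ i) \ C).card := by
      exact_mod_cast (by omega : (C \ canCover (KonigProc σ i)).card
        + 2 * matchNum (KonigProc σ i) ≤ n + (canCover (KonigProc σ i) \ C).card)
    linarith
  have hrate : ∀ i ∈ Finset.range T, rate (uncoveredPairs C) i σ
      ≤ 4 / n * ((C \ canCover (KonigProc σ i)).card : ℝ) := by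
    intro i hi
    have h3 := hs.remaining
    have h4 : (i : ℝ) ≤ T := by exact_mod_cast (Finset.mem_range.1 hi).le
    refine (rate_le (by omega) (by linarith) (C \ canCover (KonigProc σ i)) ?_).trans
      (le_of_eq (by ring))
    intro e he
    exact (Finset.mem_filter.1 he).2
  calc _ ≤ ∑ i ∈ Finset.range T, 4 / n * ((C \ canCover (KonigProc σ i)).card : ℝ) :=
        Finset.sum_le_sum hrate
    _ ≤ 4 / n * (deficiencyConst * (n : ℝ)^2 + 16 * (n : ℝ)^2) := by
        rw [← Finset.mul_sum]
        gcongr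
        refine (Finset.sum_le_sum hcard).trans ?_
        rw [Finset.sum_add_distrib]
        linarith
    _ = _ := by field_simp

lemma IsTypical.card_missing_le {n T T₁ : ℕ} {σ : EdgeOrdering n}
    (h : IsTypical T (deficiencyConst + 16) σ) (hs : IsSuitable n T T₁) (hev : Even n)
    {C : Finset (Fin n)} (hC : IsVertexCover (KonigProc σ (n*(n-1)/2)) C)
    (hC' : C.card = coverNum (KonigProc σ (n*(n-1)/2))) :
    ((Finset.univ.filter (fun f : Sym2 (Fin n) => ¬ f.IsDiag ∧ (∃ v ∈ C, v ∈ f) ∧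
      f ∉ (KonigProc σ (n*(n-1)/2)).edgeSet)).card : ℝ) ≤ (8 * (deficiencyConst + 16) + 2) * n := by
  have hCn : 2 * C.card ≤ n := by
    have h1 := konigProc_isKonig σ (n*(n-1)/2)
    have h2 := h1.two_mul_matchNum_le
    unfold IsKonig at h1
    omega
  have h1 := h.uncovered C (h.sum_rate_uncoveredPairs_le hs hev hC hCn)
  rw [sum_hit_eq_card] at h1
  refine le_trans ?_ h1.le
  obtain ⟨j, hjT, hj⟩ := h.exists_perfect_time hs hev
  refine Nat.cast_le.2 (Finset.card_le_card_of_surjOn σ.1 ?_)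
  intro f hf
  obtain ⟨hdiag, ⟨v, hv, hvf⟩, hmiss⟩ := (Finset.mem_filter.1 hf).2
  obtain ⟨k, rfl⟩ := σ.exists_eq hdiag
  have hvk : v ∉ canCover (KonigProc σ k) := fun hvk => hmiss (konigProc_accepts σ k hvk hvf k.2)
  refine ⟨k, Finset.mem_coe.2 (Finset.mem_filter.2 ⟨Finset.mem_univ _, ?_, ?_⟩), rfl⟩
  · by_contra hk
    refine hvk (Finset.mem_filter.2 ⟨Finset.mem_univ _, C, ?_, ?_, hv⟩)
    · exact IsVertexCover.anti (konigProc_mono σ k.2.le) hC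
    · have h2 := matchNum_mono (konigProc_mono σ (by omega : j ≤ k.val))
      have h3 := konigProc_isKonig σ k.val
      have h4 := (IsVertexCover.anti (konigProc_mono σ k.2.le) hC).coverNum_le_card
      unfold IsKonig at h3
      omega
  · exact Finset.mem_filter.2 ⟨Finset.mem_univ _, v, Finset.mem_sdiff.2 ⟨hv, hvk⟩, hvf⟩

/-! ### Most orderings are typical -/

lemma two_pow_mul_exp_le (n : ℕ) : (2 : ℝ) ^ n * Real.exp (-(2 * n)) ≤ Real.exp (-n) := by
  have h1 : (2 : ℝ) ≤ Real.exp 1 := by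
    have := Real.add_one_le_exp (1 : ℝ)
    linarith
  calc (2 : ℝ) ^ n * Real.exp (-(2 * n)) ≤ Real.exp 1 ^ n * Real.exp (-(2 * n)) := by gcongr
    _ = Real.exp (-n) := by
        rw [← Real.exp_nat_mul, ← Real.exp_add]
        congr 1
        ring

lemma Pr_degree_le {n T T₁ : ℕ} (hs : IsSuitable n T T₁) :
    Pr n (fun σ => ∃ v ∈ (Finset.univ : Finset (Fin n)),
      (n : ℝ) / 32 ≤ ∑ i ∈ Finset.range T, hit (incidentPairs v) i σ)
      ≤ n * Real.exp (-(3 / 128 * n)) := by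
  have hn : 0 < n := by have := hs.large; omega
  have hn' : (0 : ℝ) < n := by exact_mod_cast hn
  refine (Pr_exists_le _ _).trans ?_
  have h1 : ∀ v ∈ (Finset.univ : Finset (Fin n)), Pr n (fun σ =>
      (n : ℝ) / 32 ≤ ∑ i ∈ Finset.range T, hit (incidentPairs v) i σ)
      ≤ Real.exp (-(3 / 128 * n)) := by
    intro v _
    refine le_trans (Pr_mono fun σ hσ => ⟨?_, hσ⟩)
      ((Pr_le_hit_of_rate_le (incidentPairs_isAdapted v) ((n : ℝ) / 256) ((n : ℝ) / 32)
        (by positivity) T hs.le_total).trans (le_of_eq (by congr 1; ring)))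
    have h2 : ∀ i ∈ Finset.range T, rate (incidentPairs v) i σ ≤ 4 / n := by
      intro i hi
      have h3 := hs.remaining
      have h4 : (i : ℝ) ≤ T := by exact_mod_cast (Finset.mem_range.1 hi).le
      refine (rate_le hn (by linarith) {v} ?_).trans (le_of_eq (by simp))
      intro e he
      exact ⟨v, by simp, (Finset.mem_filter.1 he).2⟩
    have h5 := Finset.sum_le_card_nsmul _ _ _ h2
    rw [Finset.card_range, nsmul_eq_mul] at h5
    refine h5.trans ?_
    have h6 : (1024 : ℝ) * T ≤ (n : ℝ)^2 := by exact_mod_cast hs.mul_le_sq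
    rw [mul_div_assoc', div_le_iff₀ hn']
    linarith
  have h2 := Finset.sum_le_card_nsmul _ _ _ h1
  simpa using h2

lemma Pr_inside_le {n T : ℕ} (hT : T ≤ n*(n-1)/2) :
    Pr n (fun σ => ∃ I ∈ (Finset.univ : Finset (Finset (Fin n))),
      4 * (n : ℝ) ≤ ∑ i ∈ Finset.range T, rate (insidePairs I) i σ ∧
      ∑ i ∈ Finset.range T, hit (insidePairs I) i σ ≤ 0) ≤ Real.exp (-n) := by
  refine (Pr_exists_le _ _).trans (le_trans ?_ (two_pow_mul_exp_le n))
  have h1 := Finset.sum_le_card_nsmul (Finset.univ : Finset (Finset (Fin n))) _ _ fun I _ =>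
    (Pr_hit_le_of_le_rate (insidePairs_isAdapted I) (4 * (n : ℝ)) 0 (by positivity) T hT)
  refine h1.trans (le_of_eq ?_)
  rw [nsmul_eq_mul]
  simp only [Finset.card_univ, Fintype.card_finset, Fintype.card_fin]
  push_cast
  congr 2
  ring

lemma Pr_uncovered_le {n T : ℕ} (hT : T ≤ n*(n-1)/2) {K : ℝ} (hK : 0 ≤ K) :
    Pr n (fun σ => ∃ C ∈ (Finset.univ : Finset (Finset (Fin n))),
      ∑ i ∈ Finset.range T, rate (uncoveredPairs C) i σ ≤ 4 * K * n ∧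
      (8 * K + 2) * n ≤ ∑ i ∈ Finset.range T, hit (uncoveredPairs C) i σ) ≤ Real.exp (-n) := by
  refine (Pr_exists_le _ _).trans (le_trans ?_ (two_pow_mul_exp_le n))
  have h1 := Finset.sum_le_card_nsmul (Finset.univ : Finset (Finset (Fin n))) _ _ fun C _ =>
    (Pr_le_hit_of_rate_le (uncoveredPairs_isAdapted C) (4 * K * n) ((8 * K + 2) * n)
      (by positivity) T hT)
  refine h1.trans (le_of_eq ?_)
  rw [nsmul_eq_mul]
  simp only [Finset.card_univ, Fintype.card_finset, Fintype.card_fin]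
  push_cast
  congr 2
  ring

/-- The pair `(D, A)` witnesses that `escaping` fails at time `i`. -/
def EscapingFails {n : ℕ} (i : ℕ) (p : Finset (Fin n) × Finset (Fin n)) (σ : EdgeOrdering n) :
    Prop :=
  (p.1.card : ℝ) * ((i : ℝ) - 1024 * n) / (16 * n)
      ≤ ∑ j ∈ Finset.range i, rate (escapingPairs p.1 p.2) j σ ∧
    ∑ j ∈ Finset.range i, hit (escapingPairs p.1 p.2) j σ ≤ 0

lemma Pr_escapingFails_le {n i k : ℕ} (hn : 0 < n) (hi : 1024 * n ≤ i) (hiN : i ≤ n*(n-1)/2)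
    (hadm : (n.choose k : ℝ) * decay n i ^ k ≤ 1 / (n : ℝ)^2) :
    Pr n (fun σ => ∃ p ∈ Finset.powersetCard k (Finset.univ : Finset (Fin n)) ×ˢ
      Finset.powersetCard k (Finset.univ : Finset (Fin n)), EscapingFails i p σ)
      ≤ 1 / (n : ℝ)^4 := by
  have hn' : (0 : ℝ) < n := by exact_mod_cast hn
  have hi' : (1024 : ℝ) * n ≤ i := by exact_mod_cast hi
  have hnn : (0 : ℝ) ≤ k * ((i : ℝ) - 1024 * n) / (16 * n) := by
    have : (0 : ℝ) ≤ (i : ℝ) - 1024 * n := by linarith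
    positivity
  refine (Pr_exists_le _ _).trans ?_
  have h1 : ∀ p ∈ Finset.powersetCard k (Finset.univ : Finset (Fin n)) ×ˢ
      Finset.powersetCard k (Finset.univ : Finset (Fin n)),
      Pr n (EscapingFails i p) ≤ (decay n i ^ k) ^ 2 := by
    intro p hp
    have hk : p.1.card = k := (Finset.mem_powersetCard.1 (Finset.mem_product.1 hp).1).2
    unfold EscapingFails
    rw [hk]
    refine (Pr_hit_le_of_le_rate (escapingPairs_isAdapted p.1 p.2) _ 0 hnn i hiN).trans
      (le_of_eq ?_)
    unfold decay
    rw [← Real.exp_nat_mul, ← Real.exp_nat_mul]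
    congr 1
    push_cast
    field_simp
    ring
  refine (Finset.sum_le_card_nsmul _ _ _ h1).trans ?_
  rw [Finset.card_product, Finset.card_powersetCard, Finset.card_univ, Fintype.card_fin,
    nsmul_eq_mul]
  push_cast
  calc (n.choose k : ℝ) * n.choose k * (decay n i ^ k) ^ 2
      = ((n.choose k : ℝ) * decay n i ^ k) ^ 2 := by ring
    _ ≤ (1 / (n : ℝ)^2) ^ 2 := by
        have := decay_nonneg n i
        gcongr
    _ = _ := by
        field_simp

lemma Pr_escaping_le {n T T₁ : ℕ} (hs : IsSuitable n T T₁) :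
    Pr n (fun σ => ∃ i ∈ Finset.Ico (1024 * n) T, ∃ k ∈ (Finset.range (n + 1)).filter
        (fun k => (n.choose k : ℝ) * decay n i ^ k ≤ 1 / (n : ℝ)^2),
      ∃ p ∈ Finset.powersetCard k (Finset.univ : Finset (Fin n)) ×ˢ
        Finset.powersetCard k (Finset.univ : Finset (Fin n)), EscapingFails i p σ)
      ≤ 1 / n := by
  have hn : 0 < n := by have := hs.large; omega
  have hn' : (1 : ℝ) ≤ n := by exact_mod_cast hn
  refine (Pr_exists_le _ _).trans ?_
  have h1 : ∀ i ∈ Finset.Ico (1024 * n) T, Pr n (fun σ => ∃ k ∈ (Finset.range (n + 1)).filter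
        (fun k => (n.choose k : ℝ) * decay n i ^ k ≤ 1 / (n : ℝ)^2),
      ∃ p ∈ Finset.powersetCard k (Finset.univ : Finset (Fin n)) ×ˢ
        Finset.powersetCard k (Finset.univ : Finset (Fin n)), EscapingFails i p σ)
      ≤ (n + 1) * (1 / (n : ℝ)^4) := by
    intro i hi
    obtain ⟨hi1, hi2⟩ := Finset.mem_Ico.1 hi
    refine (Pr_exists_le _ _).trans ((Finset.sum_le_card_nsmul _ _ _ fun k hk =>
      Pr_escapingFails_le hn hi1 (hi2.le.trans hs.le_total) (Finset.mem_filter.1 hk).2).trans ?_)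
    rw [nsmul_eq_mul]
    gcongr
    have := Finset.card_filter_le (Finset.range (n + 1))
      (fun k => (n.choose k : ℝ) * decay n i ^ k ≤ 1 / (n : ℝ)^2)
    rw [Finset.card_range] at this
    exact_mod_cast this
  refine (Finset.sum_le_card_nsmul _ _ _ h1).trans ?_
  rw [nsmul_eq_mul, Nat.card_Ico]
  have h2 : ((T - 1024 * n : ℕ) : ℝ) ≤ T := by exact_mod_cast Nat.sub_le _ _
  have h3 : (1024 : ℝ) * T ≤ (n : ℝ)^2 := by exact_mod_cast hs.mul_le_sq
  calc ((T - 1024 * n : ℕ) : ℝ) * ((n + 1) * (1 / (n : ℝ)^4))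
      ≤ ((n : ℝ)^2 / 1024) * ((n + n) * (1 / (n : ℝ)^4)) := by
        gcongr
        linarith
    _ = (1 / 512) * (1 / (n : ℝ)) := by field_simp; norm_num
    _ ≤ 1 / (n : ℝ) := by
        have : 0 < 1 / (n : ℝ) := by positivity
        linarith

lemma Pr_not_isTypical_le {n T T₁ : ℕ} (hs : IsSuitable n T T₁) {K : ℝ} (hK : 0 ≤ K) :
    Pr n (fun σ => ¬ IsTypical T K σ) ≤ n * Real.exp (-(3 / 128 * n)) + (Real.exp (-n)
      + (Real.exp (-n) + (1 / n + Real.exp (-(1 / 2 * n))))) := by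
  have haug := Pr_hit_le_of_le_rate (n := n) augmentingPairs_isAdapted (2 * n) ((n : ℝ) / 2)
    (by positivity) T hs.le_total
  rw [show (n : ℝ) / 2 - 2 * n / 2 = -(1 / 2 * n) by ring] at haug
  refine le_trans (Pr_mono ?_) ((Pr_or_le _ _).trans (add_le_add (Pr_degree_le hs)
    ((Pr_or_le _ _).trans (add_le_add (Pr_inside_le hs.le_total)
    ((Pr_or_le _ _).trans (add_le_add (Pr_uncovered_le hs.le_total hK)
    ((Pr_or_le _ _).trans (add_le_add (Pr_escaping_le hs) haug))))))))
  intro σ hσ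
  by_contra hcon
  simp only [not_or] at hcon
  obtain ⟨h1, h2, h3, h4, h5⟩ := hcon
  refine hσ ⟨?_, ?_, ?_, ?_, ?_⟩
  · intro v
    by_contra hv
    exact h1 ⟨v, Finset.mem_univ _, not_lt.1 hv⟩
  · intro I hI
    by_contra hv
    exact h2 ⟨I, Finset.mem_univ _, not_lt.1 hv, hI⟩
  · intro C hC
    by_contra hv
    exact h3 ⟨C, Finset.mem_univ _, hC, not_lt.1 hv⟩
  · intro i hi hiT D A hDA hadm hhit
    by_contra hv
    refine h4 ⟨i, Finset.mem_Ico.2 ⟨hi, hiT⟩, D.card, Finset.mem_filter.2 ⟨?_, hadm⟩, (D, A),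
      ?_, not_lt.1 hv, hhit⟩
    · rw [Finset.mem_range, Nat.lt_succ_iff]
      simpa using Finset.card_le_univ D
    · simp [Finset.mem_powersetCard, hDA]
  · intro hhit
    by_contra hv
    exact h5 ⟨not_lt.1 hv, hhit⟩

/-! ### Asymptotics -/

lemma eventually_isSuitable :
    ∀ᶠ n : ℕ in Filter.atTop,
      IsSuitable n (n^2 / 1024) ⌈1024 * (n : ℝ) + 192 * n * Real.log n⌉₊ := by
  have hcast : Filter.Tendsto (fun n : ℕ => (n : ℝ)) Filter.atTop Filter.atTop :=
    tendsto_natCast_atTop_atTop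
  have hlog : ∀ᶠ n : ℕ in Filter.atTop,
      ‖Real.log n‖ ≤ (1 / 1000000) * ‖((n : ℝ) ^ (1 / 4 : ℝ))‖ :=
    hcast.eventually ((isLittleO_log_rpow_atTop (by norm_num : (0 : ℝ) < 1 / 4)).bound
      (by norm_num))
  filter_upwards [hlog, Filter.eventually_ge_atTop (10 ^ 40)] with n hl hn
  have hn' : (10 ^ 40 : ℝ) ≤ n := by exact_mod_cast hn
  have hn0 : (0 : ℝ) < n := by linarith
  set q : ℝ := (n : ℝ) ^ (1 / 4 : ℝ) with hq
  have hq0 : 0 < q := Real.rpow_pos_of_pos hn0 _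
  have hq4 : q ^ 4 = n := by
    rw [hq, ← Real.rpow_natCast, ← Real.rpow_mul hn0.le]
    norm_num
  have hq1 : (10 : ℝ) ^ 10 ≤ q := by
    by_contra hlt
    rw [not_le] at hlt
    have : q ^ 4 < ((10 : ℝ) ^ 10) ^ 4 := by gcongr
    rw [hq4] at this
    norm_num at this hn'
    linarith
  have hsq : √(n : ℝ) = q ^ 2 := by
    rw [← hq4, show q ^ 4 = (q ^ 2) ^ 2 by ring, Real.sqrt_sq (by positivity)]
  have hl0 : 0 ≤ Real.log n := Real.log_nonneg (by linarith)
  rw [Real.norm_of_nonneg hl0, Real.norm_of_nonneg hq0.le] at hl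
  set L := Real.log n with hL
  set T₁ := ⌈1024 * (n : ℝ) + 192 * n * L⌉₊ with hT₁
  have hT₁l : 1024 * (n : ℝ) + 192 * n * L ≤ T₁ := Nat.le_ceil _
  have hT₁u : (T₁ : ℝ) ≤ 1024 * (n : ℝ) + 192 * n * L + 1 :=
    (Nat.ceil_lt_add_one (by positivity)).le
  have hT₁q : (T₁ : ℝ) ≤ n * q / 1000 := by
    have h1 : (n : ℝ) * L ≤ n * (1 / 1000000 * q) := by gcongr
    have h2 : (n : ℝ) * 10 ^ 10 ≤ n * q := by gcongr
    norm_num at h2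
    linarith
  have hTu : 1024 * (n^2 / 1024) ≤ n^2 := Nat.mul_div_le _ _
  have hTl : n^2 < 1024 * (n^2 / 1024 + 1) := Nat.lt_mul_div_succ _ (by norm_num)
  have hTu' : (1024 : ℝ) * ((n^2 / 1024 : ℕ) : ℝ) ≤ (n : ℝ)^2 := by exact_mod_cast hTu
  have hTl' : (n : ℝ)^2 < 1024 * (((n^2 / 1024 : ℕ) : ℝ) + 1) := by exact_mod_cast hTl
  have hN : n * (n - 1) < 2 * (n * (n - 1) / 2 + 1) := Nat.lt_mul_div_succ _ (by norm_num)
  have hN' : (n : ℝ) * (n - 1) < 2 * (((n * (n - 1) / 2 : ℕ) : ℝ) + 1) := by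
    have h1 : ((n * (n - 1) : ℕ) : ℝ) < 2 * (((n * (n - 1) / 2 : ℕ) : ℝ) + 1) := by
      exact_mod_cast hN
    rwa [Nat.cast_mul, Nat.cast_sub (by omega), Nat.cast_one] at h1
  have hbig : (1000000 : ℝ) * n ≤ (n : ℝ)^2 := by
    rw [sq]
    gcongr
    linarith
  have hrem : (n : ℝ)^2 / 4 ≤ ((n*(n-1)/2 : ℕ) : ℝ) - ((n^2 / 1024 : ℕ) : ℝ) := by
    nlinarith
  refine ⟨by omega, ?_, hTu, hrem, ?_, ?_, ?_, ?_, ?_⟩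
  · have : ((n^2 / 1024 : ℕ) : ℝ) ≤ ((n*(n-1)/2 : ℕ) : ℝ) := by
      have : 0 ≤ (n : ℝ)^2 / 4 := by positivity
      linarith
    exact_mod_cast this
  · have h1 : 2 * L ≤ √(n : ℝ) := by
      rw [hsq]
      nlinarith
    calc Real.exp (-√(n : ℝ)) ≤ Real.exp (-(2 * L)) := Real.exp_le_exp.2 (by linarith)
      _ = 1 / (n : ℝ)^2 := by
        rw [Real.exp_neg, one_div, show (2 : ℝ) * L = ((2 : ℕ) : ℝ) * L by norm_num,
          Real.exp_nat_mul, hL, Real.exp_log hn0]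
  · have : (1024 : ℝ) * n ≤ T₁ := by
      have : 0 ≤ 192 * (n : ℝ) * L := by positivity
      linarith
    exact_mod_cast this
  · intro i hi
    have hi' : (T₁ : ℝ) ≤ i := by exact_mod_cast hi
    have h1 : 3 * L ≤ ((i : ℝ) - 1024 * n) / (64 * n) := by
      rw [le_div_iff₀ (by positivity)]
      linarith
    calc decay n i ≤ Real.exp (-(3 * L)) := Real.exp_le_exp.2 (by linarith)
      _ = 1 / (n : ℝ)^3 := by
        rw [Real.exp_neg, one_div, show (3 : ℝ) * L = ((3 : ℕ) : ℝ) * L by norm_num,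
          Real.exp_nat_mul, hL, Real.exp_log hn0]
  · rw [hsq]
    calc (T₁ : ℝ) * (1 + q ^ 2) ≤ (n * q / 1000) * (q ^ 2 + q ^ 2) := by
          gcongr
          nlinarith
      _ = n * q ^ 3 / 500 := by ring
      _ ≤ n * q ^ 4 := by
          have : q ^ 3 / 500 ≤ q ^ 4 := by
            have : 0 < q ^ 3 := by positivity
            nlinarith
          rw [mul_div_assoc]
          gcongr
      _ = _ := by rw [hq4]; ring
  · have h1 : (q : ℝ) ≤ n / 1000000 := by
      rw [← hq4, le_div_iff₀ (by norm_num)]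
      have h2 : ((10 : ℝ) ^ 10) ^ 3 ≤ q ^ 3 := by gcongr
      norm_num at h2
      have h3 : q * 1000000 ≤ q * q ^ 3 := by
        gcongr
        linarith
      calc _ ≤ _ := h3
        _ = _ := by ring
    have h2 : (n : ℝ) * q ≤ n * (n / 1000000) := by gcongr
    have h3 : (T₁ : ℝ) + 1024 * n < ((n^2 / 1024 : ℕ) : ℝ) := by nlinarith
    exact_mod_cast h3

lemma tendsto_failure_bound :
    Filter.Tendsto (fun x : ℝ => x * Real.exp (-(3 / 128 * x)) + (Real.exp (-x)
      + (Real.exp (-x) + (1 / x + Real.exp (-(1 / 2 * x)))))) Filter.atTop (nhds 0) := by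
  have hexp : ∀ c : ℝ, 0 < c → Filter.Tendsto (fun x : ℝ => Real.exp (-(c * x))) Filter.atTop
      (nhds 0) := fun c hc =>
    Real.tendsto_exp_neg_atTop_nhds_zero.comp (Filter.tendsto_id.const_mul_atTop hc)
  have h1 : Filter.Tendsto (fun x : ℝ => x * Real.exp (-(3 / 128 * x))) Filter.atTop (nhds 0) := by
    have := ((Real.tendsto_pow_mul_exp_neg_atTop_nhds_zero 1).comp
      (Filter.tendsto_id.const_mul_atTop (by norm_num : (0 : ℝ) < 3 / 128))).const_mul (128 / 3)
    rw [mul_zero] at this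
    refine this.congr fun x => ?_
    simp only [Function.comp, id, pow_one]
    ring
  have h2 : Filter.Tendsto (fun x : ℝ => 1 / x) Filter.atTop (nhds 0) := by
    simpa using tendsto_inv_atTop_zero (𝕜 := ℝ)
  have h3 := Real.tendsto_exp_neg_atTop_nhds_zero
  simpa using h1.add (h3.add (h3.add (h2.add (hexp (1 / 2) (by norm_num)))))

/-- There is a constant `K > 0` such that whp, for every minimum vertex cover `C` of the
final graph `G_N`, at most `K·n` vertex pairs meeting `C` are missing from `G_N`. -/
theorem koenig_process_final_graph_few_missing_pairs :
    ∃ K : ℝ, 0 < K ∧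
      Filter.Tendsto (fun k : ℕ =>
        Pr (2*k) (fun σ =>
          ∀ C : Finset (Fin (2*k)),
            IsVertexCover (KonigProc σ ((2*k)*((2*k)-1)/2)) C →
            C.card = coverNum (KonigProc σ ((2*k)*((2*k)-1)/2)) →
            ((Finset.univ.filter (fun f : Sym2 (Fin (2*k)) =>
                ¬ f.IsDiag ∧ (∃ v ∈ C, v ∈ f) ∧
                f ∉ (KonigProc σ ((2*k)*((2*k)-1)/2)).edgeSet)).card : ℝ)
              ≤ K * (2*k)))
        Filter.atTop (nhds 1) := by
  have hK : 0 < deficiencyConst + 16 := by linarith [deficiencyConst_pos]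
  refine ⟨8 * (deficiencyConst + 16) + 2, by linarith, ?_⟩
  have htwo : Filter.Tendsto (fun k : ℕ => 2 * k) Filter.atTop Filter.atTop :=
    Filter.tendsto_id.const_mul_atTop' (by norm_num)
  have hlow := (tendsto_const_nhds (x := (1 : ℝ))).sub
    (tendsto_failure_bound.comp (tendsto_natCast_atTop_atTop.comp htwo))
  rw [sub_zero] at hlow
  refine tendsto_of_tendsto_of_tendsto_of_le_of_le' hlow tendsto_const_nhds ?_
    (Filter.Eventually.of_forall fun k => Pr_le_one _)
  filter_upwards [htwo.eventually eventually_isSuitable] with k hs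
  refine le_trans (sub_le_sub_left (Pr_not_isTypical_le hs hK.le) 1)
    ((one_sub_Pr_not_le _).trans (Pr_mono fun σ hσ C hC hC' => ?_))
  have h := hσ.card_missing_le hs (even_two_mul k) hC hC'
  push_cast at h
  exact h
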